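/- arXiv:math/0101147 — 7 statements merged into one kernel-verified Lean document; each statement's English description precedes it below -/
import Mathlib

section
/- For every integer n ≥ 2 and elements z_1, …, z_n of a commutative ring, the sum over all trees T on the vertex set {1, …, n} of the monomial ∏_{i=1}^n z_i^{val_T(i)}, where val_T(i) is the degree of vertex i in T, equals z_1 ⋯ z_n · (z_1 + ⋯ + z_n)^{n-2}. (Cayley's weighted tree formula.) -/
namespace SimpleGraph

/-- The graph obtained from `H` by relabelling its vertices to avoid `v` and joining `v`
to the image of `w`. -/
def attachLeaf {n : ℕ} (v : Fin (n + 1)) (H : SimpleGraph (Fin n)) (w : Fin n) :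
    SimpleGraph (Fin (n + 1)) :=
  H.map v.succAboveEmb ⊔ edge v (v.succAbove w)

section attachLeaf

variable {n : ℕ} (v : Fin (n + 1)) (H : SimpleGraph (Fin n)) (w : Fin n)

@[simp]
lemma attachLeaf_adj_succAbove (i j : Fin n) :
    (attachLeaf v H w).Adj (v.succAbove i) (v.succAbove j) ↔ H.Adj i j := by
  simp only [attachLeaf, sup_adj, map_adj, edge_adj]
  simp [Fin.succAbove_ne]

@[simp]
lemma attachLeaf_adj_self_succAbove (j : Fin n) :
    (attachLeaf v H w).Adj v (v.succAbove j) ↔ j = w := by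
  simp only [attachLeaf, sup_adj, map_adj, edge_adj]
  simp [Fin.succAbove_ne, Fin.ne_succAbove]

@[simp]
lemma attachLeaf_adj_succAbove_self (j : Fin n) :
    (attachLeaf v H w).Adj (v.succAbove j) v ↔ j = w := by
  rw [adj_comm, attachLeaf_adj_self_succAbove]

lemma neighborSet_attachLeaf_self : (attachLeaf v H w).neighborSet v = {v.succAbove w} := by
  ext x
  obtain rfl | ⟨j, rfl⟩ := Fin.eq_self_or_eq_succAbove v x
  · simp [Fin.ne_succAbove]
  · simp

lemma ncard_neighborSet_attachLeaf_succAbove (i : Fin n) :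
    ((attachLeaf v H w).neighborSet (v.succAbove i)).ncard =
      (H.neighborSet i).ncard + if i = w then 1 else 0 := by
  have hinj := v.succAbove_right_injective
  split_ifs with h
  · have : (attachLeaf v H w).neighborSet (v.succAbove i) =
        insert v (v.succAbove '' H.neighborSet i) := by
      ext x
      obtain rfl | ⟨j, rfl⟩ := Fin.eq_self_or_eq_succAbove v x
      · simp [h]
      · simp [Fin.succAbove_ne]
    rw [this, Set.ncard_insert_of_notMem (by simp [Fin.succAbove_ne]),
      Set.ncard_image_of_injective _ hinj]
  · have : (attachLeaf v H w).neighborSet (v.succAbove i) =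
        v.succAbove '' H.neighborSet i := by
      ext x
      obtain rfl | ⟨j, rfl⟩ := Fin.eq_self_or_eq_succAbove v x
      · simp [h, Fin.succAbove_ne]
      · simp
    rw [this, Set.ncard_image_of_injective _ hinj, add_zero]

variable {H} in
lemma IsTree.attachLeaf (hH : H.IsTree) : (attachLeaf v H w).IsTree := by
  have hconn : (SimpleGraph.attachLeaf v H w).Connected := by
    let φ : H →g SimpleGraph.attachLeaf v H w :=
      ⟨v.succAbove, fun h ↦ (attachLeaf_adj_succAbove v H w _ _).2 h⟩
    refine connected_iff_exists_forall_reachable _ |>.2 ⟨v.succAbove w, fun x ↦ ?_⟩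
    obtain rfl | ⟨j, rfl⟩ := Fin.eq_self_or_eq_succAbove v x
    · exact ((attachLeaf_adj_succAbove_self x H w w).2 rfl).reachable
    · exact (hH.connected.preconnected w j).map φ
  refine isTree_iff_connected_and_card.2 ⟨hconn, ?_⟩
  have hle := hconn.card_vert_le_card_edgeSet_add_one
  have hH' := (isTree_iff_connected_and_card.1 hH).2
  have hcard : (SimpleGraph.attachLeaf v H w).edgeSet.ncard ≤ H.edgeSet.ncard + 1 := by
    rw [SimpleGraph.attachLeaf, edgeSet_sup, edgeSet_map]
    refine (Set.ncard_union_le _ _).trans (add_le_add (Set.ncard_image_le) ?_)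
    rw [edgeSet_edge_of_ne (Fin.ne_succAbove v w), Set.ncard_singleton]
  simp only [← Nat.card_coe_set_eq] at hcard
  rw [Nat.card_fin] at *
  lia

lemma comap_attachLeaf : (attachLeaf v H w).comap v.succAbove = H := by
  ext i j
  simp

end attachLeaf

lemma exists_attachLeaf_eq {n : ℕ} {v : Fin (n + 1)} {T : SimpleGraph (Fin (n + 1))}
    (hT : T.IsTree) (hv : (T.neighborSet v).ncard = 1) :
    ∃ (H : SimpleGraph (Fin n)) (w : Fin n), H.IsTree ∧ attachLeaf v H w = T := by
  classical
  obtain ⟨u, hu⟩ := Set.ncard_eq_one.1 hv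
  have hadj (x) : T.Adj v x ↔ x = u := by rw [← mem_neighborSet, hu, Set.mem_singleton_iff]
  obtain rfl | ⟨w, rfl⟩ := Fin.eq_self_or_eq_succAbove v u
  · exact ((hadj u).2 rfl).ne rfl |>.elim
  refine ⟨T.comap v.succAbove, w, ⟨?_, hT.isAcyclic.of_comap v.succAboveEmb⟩, ?_⟩
  · have hdeg : T.degree v = 1 := by
      rw [← card_neighborSet_eq_degree, ← Nat.card_eq_fintype_card, Nat.card_coe_set_eq, hv]
    let e : T.comap v.succAbove ≃g T.induce {v}ᶜ :=
      ⟨finSuccAboveEquiv v, by intros; rfl⟩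
    exact e.connected_iff.2 (hT.connected.induce_compl_singleton_of_degree_eq_one hdeg)
  · ext x y
    obtain hx | ⟨i, rfl⟩ := Fin.eq_self_or_eq_succAbove v x
    all_goals obtain hy | ⟨j, rfl⟩ := Fin.eq_self_or_eq_succAbove v y
    · simp [hx, hy]
    · simp [hx, hadj]
    · simp [hy, T.adj_comm _ v, hadj]
    · simp

lemma IsTree.ncard_neighborSet_pos {n : ℕ} {T : SimpleGraph (Fin (n + 2))} (hT : T.IsTree)
    (i : Fin (n + 2)) : 0 < (T.neighborSet i).ncard := by
  classical
  rw [← Nat.card_coe_set_eq, Nat.card_eq_fintype_card, card_neighborSet_eq_degree]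
  exact hT.connected.preconnected.degree_pos_of_nontrivial i

lemma IsTree.sum_ncard_neighborSet_sub_one {n : ℕ} {T : SimpleGraph (Fin (n + 2))}
    (hT : T.IsTree) : ∑ i, ((T.neighborSet i).ncard - 1) = n := by
  classical
  have hsum := T.sum_degrees_eq_twice_card_edges
  have hcard := hT.card_edgeFinset
  have hdeg (i) : T.degree i = ((T.neighborSet i).ncard - 1) + 1 := by
    rw [Nat.sub_add_cancel (hT.ncard_neighborSet_pos i), ← Nat.card_coe_set_eq,
      Nat.card_eq_fintype_card, card_neighborSet_eq_degree]
  simp only [hdeg, Finset.sum_add_distrib, Finset.sum_const, Finset.card_univ,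
    Fintype.card_fin, smul_eq_mul] at hsum hcard
  lia

open Classical in
/-- The sum over all trees `T` on `Fin n` of `∏ i, z i ^ (deg_T i - 1)`. -/
noncomputable def reducedTreeSum {R : Type*} [CommRing R] {n : ℕ} (z : Fin n → R) : R :=
  ∑ T : SimpleGraph (Fin n) with T.IsTree, ∏ i, z i ^ ((T.neighborSet i).ncard - 1)

lemma map_reducedTreeSum {R S : Type*} [CommRing R] [CommRing S] (φ : R →+* S) {n : ℕ}
    (z : Fin n → R) : φ (reducedTreeSum z) = reducedTreeSum (fun i ↦ φ (z i)) := by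
  simp [reducedTreeSum]

lemma reducedTreeSum_eq_of_apply_eq_zero {R : Type*} [CommRing R] {n : ℕ} (z : Fin (n + 3) → R)
    (v : Fin (n + 3)) (hv : z v = 0) :
    reducedTreeSum z = (∑ i, z i) * reducedTreeSum (fun i ↦ z (v.succAbove i)) := by
  classical
  have hleaf : reducedTreeSum z = ∑ T : SimpleGraph (Fin (n + 3)) with
      T.IsTree ∧ (T.neighborSet v).ncard = 1, ∏ i, z i ^ ((T.neighborSet i).ncard - 1) := by
    refine (Finset.sum_subset (fun T hT ↦ ?_) fun T hT hT' ↦ ?_).symm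
    · simp_all
    · simp only [Finset.mem_filter, Finset.mem_univ, true_and] at hT hT'
      have := hT.ncard_neighborSet_pos v
      refine Finset.prod_eq_zero (Finset.mem_univ v) ?_
      rw [hv, zero_pow]
      have : (T.neighborSet v).ncard ≠ 1 := fun h ↦ hT' ⟨hT, h⟩
      lia
  rw [hleaf, Fin.sum_univ_succAbove _ v, hv, zero_add, reducedTreeSum, mul_comm,
    Finset.sum_mul_sum, ← Finset.sum_product']
  refine (Finset.sum_bij (fun p _ ↦ attachLeaf v p.1 p.2) ?_ ?_ ?_ ?_).symm
  · rintro ⟨H, w⟩ h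
    simp only [Finset.mem_product, Finset.mem_filter, Finset.mem_univ, true_and, and_true] at h
    simp [h.attachLeaf, neighborSet_attachLeaf_self]
  · rintro ⟨H, w⟩ - ⟨H', w'⟩ - h
    dsimp only at h
    have hH : H = H' := by rw [← comap_attachLeaf v H w, h, comap_attachLeaf]
    have hw : w = w' := by
      rw [← attachLeaf_adj_self_succAbove v H' w', ← h, attachLeaf_adj_self_succAbove]
    rw [hH, hw]
  · intro T hT
    simp only [Finset.mem_filter, Finset.mem_univ, true_and] at hT
    obtain ⟨H, w, hH, rfl⟩ := exists_attachLeaf_eq hT.1 hT.2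
    exact ⟨(H, w), by simpa using hH, rfl⟩
  · rintro ⟨H, w⟩ h
    simp only [Finset.mem_product, Finset.mem_filter, Finset.mem_univ, true_and, and_true] at h
    have hpow (i) : z (v.succAbove i) ^
        (((attachLeaf v H w).neighborSet (v.succAbove i)).ncard - 1) =
        z (v.succAbove i) ^ ((H.neighborSet i).ncard - 1) *
          if i = w then z (v.succAbove i) else 1 := by
      have := h.ncard_neighborSet_pos i
      rw [ncard_neighborSet_attachLeaf_succAbove, Nat.sub_add_comm this, pow_add]
      split_ifs <;> simp
    rw [Fin.prod_univ_succAbove _ v, neighborSet_attachLeaf_self]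
    simp only [hpow, Finset.prod_mul_distrib]
    simp

lemma isTree_fin_two_iff {T : SimpleGraph (Fin 2)} : T.IsTree ↔ T = ⊤ := by
  refine ⟨fun hT ↦ ?_, ?_⟩
  · have h : T.Adj 0 1 := by
      obtain ⟨x, hx⟩ := Set.nonempty_of_ncard_ne_zero (hT.ncard_neighborSet_pos 0).ne'
      have := (T.mem_neighborSet 0 x).1 hx
      fin_cases x
      · exact (this.ne rfl).elim
      · exact this
    ext x y
    fin_cases x <;> fin_cases y <;> simp [h, h.symm]
  · rintro rfl
    exact ⟨connected_top, .of_card_le_two (by simp)⟩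

lemma reducedTreeSum_fin_two {R : Type*} [CommRing R] (z : Fin 2 → R) :
    reducedTreeSum z = 1 := by
  classical
  have h (i : Fin 2) : ((⊤ : SimpleGraph (Fin 2)).neighborSet i).ncard - 1 = 0 := by
    have := (isTree_fin_two_iff.2 rfl).sum_ncard_neighborSet_sub_one
    exact Finset.sum_eq_zero_iff.1 this i (Finset.mem_univ i)
  simp only [reducedTreeSum, isTree_fin_two_iff, Finset.sum_filter, Finset.sum_ite_eq',
    Finset.mem_univ, if_true, h, pow_zero, Finset.prod_const_one]

end SimpleGraph

namespace MvPolynomial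

lemma coeff_aeval_update_X_zero {σ R : Type*} [DecidableEq σ] [CommRing R] (v : σ) {d : σ →₀ ℕ}
    (hd : d v = 0) (p : MvPolynomial σ R) :
    coeff d (aeval (Function.update X v 0 : σ → MvPolynomial σ R) p) = coeff d p := by
  induction p using MvPolynomial.induction_on' with
  | add p q hp hq => rw [map_add, coeff_add, coeff_add, hp, hq]
  | monomial e c =>
    by_cases he : e v = 0
    · congr 1
      rw [aeval_monomial, monomial_eq, algebraMap_eq]
      congr 1
      refine Finsupp.prod_congr fun i hi ↦ ?_
      rw [Function.update_of_ne]
      rintro rfl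
      exact (Finsupp.mem_support_iff.1 hi) he
    · have hne : e ≠ d := by rintro rfl; exact he hd
      rw [aeval_monomial, Finsupp.prod, Finset.prod_eq_zero (i := v) (by simpa using he)
        (by simp [he])]
      simp [coeff_monomial, hne]

/-- A homogeneous polynomial of degree less than the number of variables is determined by its
restrictions to the coordinate hyperplanes. -/
lemma eq_of_isHomogeneous_of_aeval_update_X_zero {σ R : Type*} [Fintype σ] [DecidableEq σ]
    [CommRing R] {p q : MvPolynomial σ R} {k : ℕ} (hp : p.IsHomogeneous k)
    (hq : q.IsHomogeneous k) (hk : k < Fintype.card σ)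
    (h : ∀ v, aeval (Function.update X v 0 : σ → MvPolynomial σ R) p =
      aeval (Function.update X v 0 : σ → MvPolynomial σ R) q) : p = q := by
  ext d
  by_cases hd : d.degree = k
  · obtain ⟨v, hv⟩ : ∃ v, d v = 0 := by
      by_contra! hne
      have : ∑ _v : σ, 1 ≤ ∑ v, d v :=
        Finset.sum_le_sum fun v _ ↦ Nat.one_le_iff_ne_zero.2 (hne v)
      rw [← Finsupp.degree_eq_sum, hd] at this
      simp at this
      lia
    rw [← coeff_aeval_update_X_zero v hv p, h v, coeff_aeval_update_X_zero v hv]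
  · rw [hp.coeff_eq_zero hd, hq.coeff_eq_zero hd]

end MvPolynomial

namespace SimpleGraph

open MvPolynomial in
lemma isHomogeneous_reducedTreeSum_X (n : ℕ) :
    (reducedTreeSum (X : Fin (n + 2) → MvPolynomial (Fin (n + 2)) ℤ)).IsHomogeneous n := by
  classical
  refine IsHomogeneous.sum _ _ _ fun T hT ↦ ?_
  have hT : T.IsTree := by simpa using hT
  have := IsHomogeneous.prod Finset.univ
    (fun i ↦ (X i : MvPolynomial (Fin (n + 2)) ℤ) ^ ((T.neighborSet i).ncard - 1)) _
    fun i _ ↦ isHomogeneous_X_pow i _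
  rwa [hT.sum_ncard_neighborSet_sub_one] at this

open MvPolynomial in
lemma reducedTreeSum_X (n : ℕ) :
    reducedTreeSum (X : Fin (n + 2) → MvPolynomial (Fin (n + 2)) ℤ) = (∑ i, X i) ^ n := by
  induction n with
  | zero => rw [reducedTreeSum_fin_two, pow_zero]
  | succ n ih =>
    refine eq_of_isHomogeneous_of_aeval_update_X_zero (isHomogeneous_reducedTreeSum_X (n + 1)) ?_
      (by simp) fun v ↦ ?_
    · simpa using (IsHomogeneous.sum Finset.univ _ 1
        fun i _ ↦ isHomogeneous_X ℤ (i : Fin (n + 3))).pow (n + 1)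
    · set z : Fin (n + 3) → MvPolynomial (Fin (n + 3)) ℤ := Function.update X v 0 with hz
      have hzv : z v = 0 := by simp [hz]
      have key := congrArg (aeval fun i ↦ z (v.succAbove i)).toRingHom ih
      rw [map_reducedTreeSum] at key
      have hl := map_reducedTreeSum (aeval z).toRingHom (X : Fin (n + 3) → MvPolynomial _ ℤ)
      simp only [AlgHom.toRingHom_eq_coe, RingHom.coe_coe, aeval_X, map_pow, map_sum] at key hl ⊢
      rw [hl, reducedTreeSum_eq_of_apply_eq_zero z v hzv, key, pow_succ',
        Fin.sum_univ_succAbove z v, hzv, zero_add]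

lemma reducedTreeSum_eq {R : Type*} [CommRing R] (n : ℕ) (z : Fin (n + 2) → R) :
    reducedTreeSum z = (∑ i, z i) ^ n := by
  have h := congrArg (MvPolynomial.aeval z).toRingHom (reducedTreeSum_X n)
  rw [map_reducedTreeSum] at h
  simpa using h

end SimpleGraph


/-- **Cayley's weighted tree formula.** For every `n ≥ 2` and elements `z 1, …, z n`
of a commutative ring, the sum over all trees `T` on the vertex set `{1, …, n}`
(simple graphs on `Fin n` that are connected and acyclic) of `∏ i, z i ^ (degree of i in T)`
equals `z 1 ⋯ z n · (z 1 + ⋯ + z n) ^ (n - 2)`.  The degree of the vertex `i` is the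
number of neighbors of `i`, i.e. `(T.neighborSet i).ncard`. -/
theorem cayley_weighted_tree_formula (R : Type*) [CommRing R] (n : ℕ) (hn : 2 ≤ n)
    (z : Fin n → R) :
    ∑ᶠ T : {G : SimpleGraph (Fin n) // G.Connected ∧ G.IsAcyclic},
        ∏ i : Fin n, z i ^ ((T : SimpleGraph (Fin n)).neighborSet i).ncard =
      (∏ i : Fin n, z i) * (∑ i : Fin n, z i) ^ (n - 2) := by
  classical
  obtain ⟨n, rfl⟩ := Nat.exists_eq_add_of_le' hn
  have htree (T : SimpleGraph (Fin (n + 2))) : T.IsTree ↔ T.Connected ∧ T.IsAcyclic :=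
    ⟨fun h ↦ ⟨h.connected, h.isAcyclic⟩, fun h ↦ ⟨h.1, h.2⟩⟩
  rw [Nat.add_sub_cancel, ← SimpleGraph.reducedTreeSum_eq, SimpleGraph.reducedTreeSum,
    finsum_eq_sum_of_fintype, Finset.mul_sum]
  rw [Finset.sum_subtype (p := fun T : SimpleGraph (Fin (n + 2)) ↦ T.Connected ∧ T.IsAcyclic) _
    (by simp [htree])]
  refine Finset.sum_congr rfl fun T _ ↦ ?_
  rw [← Finset.prod_mul_distrib]
  refine Finset.prod_congr rfl fun i _ ↦ ?_
  rw [← pow_succ', Nat.sub_add_cancel (((htree T).2 T.2).ncard_neighborSet_pos i)]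
end

section
/- For every integer n ≥ 2, the number of trees on the vertex set {1, …, n} equals n^{n-2}. (Cayley's formula, the count |V(n)| = n^{n-2}.) -/
open scoped Classical in
/-- The trees on `Fin n` in which every vertex `v` has degree `d v + 1`. -/
abbrev TreesWithDegree (n : ℕ) (d : Fin n → ℤ) : Type :=
  {G : SimpleGraph (Fin n) // G.IsTree ∧ ∀ v, (G.degree v : ℤ) = d v + 1}

/-- The words of length `m` over the alphabet `Fin n` in which every letter `v` occurs
`d v` times. -/
abbrev WordsWithCount (m n : ℕ) (d : Fin n → ℤ) : Type :=
  {f : Fin m → Fin n // ∀ v, (∑ i, if f i = v then 1 else 0 : ℤ) = d v}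

/-- The graph obtained from `G` by adding a new vertex `l` adjacent to `p` only. -/
def addLeaf {n : ℕ} (l : Fin (n + 1)) (p : Fin n) (G : SimpleGraph (Fin n)) :
    SimpleGraph (Fin (n + 1)) :=
  G.map l.succAboveEmb ⊔ SimpleGraph.edge l (l.succAbove p)

section AddLeaf

variable {n : ℕ} (l : Fin (n + 1)) (p : Fin n) (G : SimpleGraph (Fin n))

lemma addLeaf_adj_succAbove (u v : Fin n) :
    (addLeaf l p G).Adj (l.succAbove u) (l.succAbove v) ↔ G.Adj u v := by
  have h := SimpleGraph.map_adj_apply (G := G) (f := l.succAboveEmb) (a := u) (b := v)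
  simp only [Fin.coe_succAboveEmb] at h
  simp [addLeaf, SimpleGraph.edge_adj, h]

lemma map_not_adj_self (v : Fin (n + 1)) : ¬ (G.map l.succAboveEmb).Adj l v := by
  rw [SimpleGraph.map_adj]
  rintro ⟨a, b, -, h, -⟩
  exact Fin.succAbove_ne l a h

lemma addLeaf_adj_self (v : Fin n) : (addLeaf l p G).Adj l (l.succAbove v) ↔ v = p := by
  have h := map_not_adj_self l G (l.succAbove v)
  rw [Fin.coe_succAboveEmb] at h
  simp [addLeaf, SimpleGraph.edge_adj, h]

open scoped Classical in
lemma degree_eq_sum {V : Type*} [Fintype V] (H : SimpleGraph V) (v : V) :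
    (H.degree v : ℤ) = ∑ w, if H.Adj v w then 1 else 0 := by
  rw [← SimpleGraph.card_neighborFinset_eq_degree, SimpleGraph.neighborFinset_eq_filter]
  simp

open scoped Classical in
lemma degree_addLeaf_self : ((addLeaf l p G).degree l : ℤ) = 1 := by
  simp [degree_eq_sum, Fin.sum_univ_succAbove _ l, addLeaf_adj_self]

open scoped Classical in
lemma degree_addLeaf_succAbove (v : Fin n) :
    ((addLeaf l p G).degree (l.succAbove v) : ℤ) = (if v = p then 1 else 0) + G.degree v := by
  simp [degree_eq_sum, Fin.sum_univ_succAbove _ l, addLeaf_adj_succAbove,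
    (addLeaf l p G).adj_comm (l.succAbove v) l, addLeaf_adj_self]

lemma comap_addLeaf : (addLeaf l p G).comap l.succAbove = G := by
  ext u v
  simp [addLeaf_adj_succAbove]

lemma eq_addLeaf (H : SimpleGraph (Fin (n + 1))) (hp : ∀ v, H.Adj l (l.succAbove v) ↔ v = p) :
    addLeaf l p (H.comap l.succAbove) = H := by
  ext u v
  rcases Fin.eq_self_or_eq_succAbove l u with hu | ⟨u, rfl⟩ <;>
  rcases Fin.eq_self_or_eq_succAbove l v with hv | ⟨v, rfl⟩ <;>
  subst_vars
  · simp
  · simp [addLeaf_adj_self, hp]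
  · rw [SimpleGraph.adj_comm, H.adj_comm, addLeaf_adj_self, hp]
  · simp [addLeaf_adj_succAbove]

open scoped Classical in
lemma exists_addLeaf_eq (H : SimpleGraph (Fin (n + 1))) (hl : H.degree l = 1) :
    ∃ p G, addLeaf l p G = H := by
  obtain ⟨w, hw, hu⟩ := SimpleGraph.degree_eq_one_iff_existsUnique_adj.1 hl
  rcases Fin.eq_self_or_eq_succAbove l w with rfl | ⟨p, rfl⟩
  · simp at hw
  · exact ⟨p, _, eq_addLeaf l p H fun v =>
      ⟨fun h => Fin.succAbove_right_injective (hu _ h), fun h => h ▸ hw⟩⟩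

lemma isTree_of_isTree_addLeaf (h : (addLeaf l p G).IsTree) : G.IsTree := by
  classical
  have hacyc : G.IsAcyclic := by
    have := h.isAcyclic.of_comap l.succAboveEmb
    rwa [Fin.coe_succAboveEmb, comap_addLeaf] at this
  have hconn := h.connected.induce_compl_singleton_of_degree_eq_one (v := l)
    (by exact_mod_cast degree_addLeaf_self l p G)
  let f : Fin n ≃ ({l}ᶜ : Set (Fin (n + 1))) :=
    Equiv.ofBijective (fun v => ⟨l.succAbove v, Fin.succAbove_ne l v⟩)
      ⟨fun a b hab => Fin.succAbove_right_injective (congrArg Subtype.val hab), fun w => by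
        obtain ⟨v, hv⟩ := Fin.exists_succAbove_eq w.2
        exact ⟨v, Subtype.ext hv⟩⟩
  let e : G ≃g (addLeaf l p G).induce {l}ᶜ := ⟨f, addLeaf_adj_succAbove l p G _ _⟩
  exact ⟨e.connected_iff.2 hconn, hacyc⟩

lemma isTree_addLeaf (h : G.IsTree) : (addLeaf l p G).IsTree := by
  classical
  rw [SimpleGraph.isTree_iff_connected_and_card]
  refine ⟨?_, ?_⟩
  · let f : G →g addLeaf l p G := ⟨l.succAbove, (addLeaf_adj_succAbove l p G _ _).2⟩
    rw [SimpleGraph.connected_iff_exists_forall_reachable]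
    refine ⟨l, fun w => ?_⟩
    rcases Fin.eq_self_or_eq_succAbove l w with rfl | ⟨v, rfl⟩
    · rfl
    · exact (((addLeaf_adj_self l p G p).2 rfl).reachable).trans
        ((h.connected.preconnected p v).map f)
  · have hG := h.card_edgeFinset
    have h1 := congrArg (Nat.cast : ℕ → ℤ) G.sum_degrees_eq_twice_card_edges
    have h2 := congrArg (Nat.cast : ℕ → ℤ) (addLeaf l p G).sum_degrees_eq_twice_card_edges
    push_cast at h1 h2
    simp only [Fin.sum_univ_succAbove _ l, degree_addLeaf_self, degree_addLeaf_succAbove,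
      Finset.sum_add_distrib, Finset.sum_ite_eq', Finset.mem_univ, if_true, h1] at h2
    rw [Nat.card_eq_fintype_card, ← SimpleGraph.edgeFinset_card]
    simp only [Fintype.card_fin, Nat.card_fin] at hG ⊢
    lia

end AddLeaf

/-- Deleting the leaf `l`. -/
lemma card_treesWithDegree_succ {n : ℕ} (d : Fin (n + 1) → ℤ) (l : Fin (n + 1)) (hl : d l = 0) :
    Nat.card (TreesWithDegree (n + 1) d) =
      Nat.card (Σ p : Fin n,
        TreesWithDegree n fun v => d (l.succAbove v) - if v = p then 1 else 0) := by
  classical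
  symm
  refine Nat.card_congr (Equiv.ofBijective (fun x => ⟨addLeaf l x.1 x.2.1, ?_, ?_⟩) ⟨?_, ?_⟩)
  · exact isTree_addLeaf _ _ _ x.2.2.1
  · intro v
    rcases Fin.eq_self_or_eq_succAbove l v with rfl | ⟨v, rfl⟩
    · rw [hl, zero_add, degree_addLeaf_self]
    · have := degree_addLeaf_succAbove l x.1 x.2.1 v
      have h2 := x.2.2.2 v
      rw [this, h2]
      ring
  · rintro ⟨p, G, hG⟩ ⟨q, H, hH⟩ h
    have h : addLeaf l p G = addLeaf l q H := congrArg Subtype.val h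
    obtain rfl : p = q := by
      rw [← addLeaf_adj_self l q H, ← h, addLeaf_adj_self]
    obtain rfl : G = H := by
      rw [← comap_addLeaf l p G, h, comap_addLeaf]
    rfl
  · rintro ⟨H, hH, hd⟩
    obtain ⟨p, G, rfl⟩ :=
      exists_addLeaf_eq l H (by have := hd l; rw [hl] at this; exact_mod_cast this)
    refine ⟨⟨p, G, isTree_of_isTree_addLeaf l p G hH, fun v => ?_⟩, rfl⟩
    have := hd (l.succAbove v)
    rw [degree_addLeaf_succAbove] at this
    linarith

/-- Deleting the first letter, when the letter `l` does not occur. -/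
lemma card_wordsWithCount_succ {m n : ℕ} (d : Fin (n + 1) → ℤ) (l : Fin (n + 1)) (hl : d l = 0) :
    Nat.card (WordsWithCount (m + 1) (n + 1) d) =
      Nat.card (Σ p : Fin n,
        WordsWithCount m n fun v => d (l.succAbove v) - if v = p then 1 else 0) := by
  symm
  refine Nat.card_congr (Equiv.ofBijective
    (fun x => ⟨fun i => l.succAbove ((Fin.cons x.1 x.2.1 : Fin (m + 1) → Fin n) i), ?_⟩) ⟨?_, ?_⟩)
  · intro v
    rcases Fin.eq_self_or_eq_succAbove l v with rfl | ⟨v, rfl⟩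
    · simp [hl]
    · have := x.2.2 v
      simp only [Fin.succAbove_right_inj, Fin.sum_univ_succ, Fin.cons_zero, Fin.cons_succ, this,
        eq_comm (a := v)]
      ring
  · rintro ⟨p, f, hf⟩ ⟨q, g, hg⟩ h
    have h := Fin.succAbove_right_injective.comp_left (congrArg Subtype.val h)
    obtain ⟨rfl, rfl⟩ := Fin.cons_inj.1 h
    rfl
  · rintro ⟨g, hg⟩
    have hne : ∀ i, g i ≠ l := by
      have := hg l
      rw [hl, Finset.sum_eq_zero_iff_of_nonneg (by intros; positivity)] at this
      simpa using this
    choose f hf using fun i => Fin.exists_succAbove_eq (hne i)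
    refine ⟨⟨f 0, fun i => f i.succ, fun v => ?_⟩, ?_⟩
    · have := hg (l.succAbove v)
      simp only [← hf, Fin.succAbove_right_inj, Fin.sum_univ_succ] at this
      simp [← this, eq_comm (a := v)]
    · apply Subtype.ext
      funext i
      refine Fin.cases ?_ (fun i => ?_) i <;> simp [hf]

lemma exists_eq_zero_of_tree {n : ℕ} {d : Fin (n + 2) → ℤ} (G : TreesWithDegree (n + 2) d) :
    ∃ l, d l = 0 := by
  classical
  obtain ⟨l, hl⟩ := G.2.1.exists_vert_degree_one_of_nontrivial
  have := G.2.2 l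
  exact ⟨l, by rw [hl] at this; push_cast at this; linarith⟩

lemma exists_eq_zero_of_word {m n : ℕ} (hmn : m < n) {d : Fin n → ℤ} (f : WordsWithCount m n d) :
    ∃ l, d l = 0 := by
  have : ¬ Function.Surjective f.1 := fun h => by
    have := Fintype.card_le_of_surjective _ h
    simp at this
    omega
  simp only [Function.Surjective, not_forall, not_exists] at this
  obtain ⟨l, hl⟩ := this
  exact ⟨l, by simp [← f.2 l, hl]⟩

lemma isTree_fin_two_iff (G : SimpleGraph (Fin 2)) : G.IsTree ↔ G = ⊤ := by
  constructor
  · intro h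
    have h01 : G.Adj 0 1 := by
      obtain ⟨w, hw⟩ := h.connected.preconnected.exists_adj_of_nontrivial 0
      fin_cases w
      · simp at hw
      · exact hw
    ext u v
    fin_cases u <;> fin_cases v <;> simp [h01, h01.symm]
  · rintro rfl
    exact ⟨SimpleGraph.connected_top, SimpleGraph.IsAcyclic.of_card_le_two (by simp)⟩

/-- Trees are equidistributed with words, by degrees and letter counts. -/
theorem card_treesWithDegree (n : ℕ) (d : Fin (n + 2) → ℤ) :
    Nat.card (TreesWithDegree (n + 2) d) = Nat.card (WordsWithCount n (n + 2) d) := by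
  induction n with
  | zero =>
    classical
    refine Nat.card_congr ⟨fun G => ⟨Fin.elim0, fun v => ?_⟩, fun f => ⟨⊤, ?_, fun v => ?_⟩,
      fun G => ?_, fun f => ?_⟩
    · have h := G.2.2 v
      simp only [(isTree_fin_two_iff _).1 G.2.1, degree_eq_sum] at h
      fin_cases v <;> simp at h ⊢ <;> linarith
    · exact (isTree_fin_two_iff _).2 rfl
    · have h := f.2 v
      simp only [degree_eq_sum, ← h]
      fin_cases v <;> simp
    · exact Subtype.ext ((isTree_fin_two_iff _).1 G.2.1).symm
    · exact Subtype.ext (Subsingleton.elim _ _)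
  | succ n ih =>
    by_cases h : ∃ l, d l = 0
    · obtain ⟨l, hl⟩ := h
      rw [card_treesWithDegree_succ d l hl, card_wordsWithCount_succ d l hl, Nat.card_sigma,
        Nat.card_sigma]
      exact Finset.sum_congr rfl fun p _ => ih _
    · have : IsEmpty (TreesWithDegree (n + 1 + 2) d) := ⟨fun G => h (exists_eq_zero_of_tree G)⟩
      have : IsEmpty (WordsWithCount (n + 1) (n + 1 + 2) d) :=
        ⟨fun f => h (exists_eq_zero_of_word (by omega) f)⟩
      simp

/-- **Cayley's formula.** For every `n ≥ 2`, the number of trees on the vertex set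
`{1, …, n}` (simple graphs on `Fin n` that are connected and acyclic) is `n ^ (n - 2)`. -/
theorem cayley_formula (n : ℕ) (hn : 2 ≤ n) :
    Nat.card {G : SimpleGraph (Fin n) // G.Connected ∧ G.IsAcyclic} = n ^ (n - 2) := by
  classical
  obtain ⟨n, rfl⟩ := Nat.exists_eq_add_of_le' hn
  let degrees : {G : SimpleGraph (Fin (n + 2)) // G.Connected ∧ G.IsAcyclic} → Fin (n + 2) → ℤ :=
    fun G v => G.1.degree v - 1
  let counts : (Fin n → Fin (n + 2)) → Fin (n + 2) → ℤ :=
    fun f v => ∑ i, if f i = v then 1 else 0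
  have key (d) : Nonempty ({G // degrees G = d} ≃ {f // counts f = d}) := by
    refine ⟨Equiv.trans ?_ ((Finite.card_eq.1 (card_treesWithDegree n d)).some.trans ?_)⟩
    · exact
        { toFun := fun G => ⟨G.1.1, ⟨G.1.2.1, G.1.2.2⟩, fun v => by
            rw [← congrFun G.2 v]; simp [degrees]⟩
          invFun := fun G => ⟨⟨G.1, G.2.1.connected, G.2.1.isAcyclic⟩, funext fun v => by
            simp [degrees, G.2.2 v]⟩
          left_inv := fun _ => rfl
          right_inv := fun _ => rfl }
    · exact Equiv.subtypeEquivRight fun f => funext_iff.symm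
  have e (d) := (key d).some
  rw [Nat.card_congr (((Equiv.sigmaFiberEquiv degrees).symm.trans
    (Equiv.sigmaCongrRight e)).trans (Equiv.sigmaFiberEquiv counts))]
  simp
end

section
/- For every integer n ≥ 2 and every integer k with 0 ≤ k ≤ n-2, the number of trees on the vertex set {1, …, n} in which vertex 1 has degree exactly k+1 equals (n-1)^{n-k-2} · C(n-2, k), where C denotes the binomial coefficient. -/
/-- `Exits f a` says that iterating the partial map `f : A → A ⊕ B` from `a` eventually
leads to `B`. -/
inductive Exits {A B : Type} (f : A → A ⊕ B) : A → Prop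
  | base {a : A} {b : B} (h : f a = Sum.inr b) : Exits f a
  | step {a a' : A} (h : f a = Sum.inl a') (h' : Exits f a') : Exits f a

/-- Parent functions of rooted forests with vertex set `A ⊕ B` and root set `B`. -/
def ParentMap (A B : Type) : Type := {f : A → A ⊕ B // ∀ a, Exits f a}

instance (A B : Type) [Finite A] [Finite B] : Finite (ParentMap A B) :=
  inferInstanceAs (Finite {f : A → A ⊕ B // ∀ a, Exits f a})

section Decomposition

variable {A B : Type} [DecidableEq A] {s : Finset A}

/-- Attach the vertices in `s` to the roots by `g` and the remaining ones by `h`. -/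
def glueParents (g : s → B) (h : {a // a ∉ s} → {a // a ∉ s} ⊕ s) (a : A) : A ⊕ B :=
  if ha : a ∈ s then Sum.inr (g ⟨a, ha⟩)
  else Sum.inl (Sum.elim Subtype.val Subtype.val (h ⟨a, ha⟩))

theorem glueParents_of_mem (g : s → B) (h : {a // a ∉ s} → {a // a ∉ s} ⊕ s) {a : A}
    (ha : a ∈ s) : glueParents g h a = Sum.inr (g ⟨a, ha⟩) := dif_pos ha

theorem glueParents_of_notMem (g : s → B) (h : {a // a ∉ s} → {a // a ∉ s} ⊕ s) {a : A}
    (ha : a ∉ s) :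
    glueParents g h a = Sum.inl (Sum.elim Subtype.val Subtype.val (h ⟨a, ha⟩)) := dif_neg ha

theorem isRight_glueParents (g : s → B) (h : {a // a ∉ s} → {a // a ∉ s} ⊕ s) (a : A) :
    (glueParents g h a).isRight ↔ a ∈ s := by
  by_cases ha : a ∈ s
  · simp [glueParents_of_mem g h ha, ha]
  · simp [glueParents_of_notMem g h ha, ha]

theorem forall_exits_glueParents (g : s → B) (h : {a // a ∉ s} → {a // a ∉ s} ⊕ s) :
    (∀ a, Exits (glueParents g h) a) ↔ ∀ a, Exits h a := by
  constructor
  · intro H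
    have key : ∀ a, Exits (glueParents g h) a → ∀ ha : a ∉ s, Exits h ⟨a, ha⟩ := by
      intro a hE
      induction hE with
      | base hb =>
        intro ha
        simp [glueParents_of_notMem g h ha] at hb
      | @step a a' hb _ ih =>
        intro ha
        rw [glueParents_of_notMem g h ha, Sum.inl.injEq] at hb
        rcases hc : h ⟨a, ha⟩ with c | c
        · simp only [hc, Sum.elim_inl] at hb
          subst hb
          exact .step hc (ih c.2)
        · exact .base hc
    exact fun a => key a (H a) a.2
  · intro H
    have hs : ∀ a ∈ s, Exits (glueParents g h) a :=
      fun a ha => .base (glueParents_of_mem g h ha)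
    have key : ∀ a, Exits h a → Exits (glueParents g h) a := by
      intro a hE
      induction hE with
      | @base a b hb =>
        exact .step (glueParents_of_notMem g h a.2) (by simpa [hb] using hs b b.2)
      | @step a a' hb _ ih =>
        exact .step (glueParents_of_notMem g h a.2) (by simpa [hb] using ih)
    intro a
    by_cases ha : a ∈ s
    · exact hs a ha
    · exact key ⟨a, ha⟩ (H _)

theorem glueParents_injective : Function.Injective
    fun p : (s → B) × ({a // a ∉ s} → {a // a ∉ s} ⊕ s) => glueParents p.1 p.2 := by
  rintro ⟨g, h⟩ ⟨g', h'⟩ heq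
  simp only [Prod.mk.injEq]
  constructor
  · funext a
    simpa [glueParents_of_mem _ _ a.2] using congrFun heq a.1
  · funext a
    have := congrFun heq a.1
    simp only [glueParents_of_notMem _ _ a.2, Sum.inl.injEq, Subtype.coe_eta] at this
    rcases ha : h a with c | c <;> rcases ha' : h' a with c' | c' <;>
      simp only [ha, ha', Sum.elim_inl, Sum.elim_inr] at this
    · rw [Subtype.ext this]
    · exact absurd (this ▸ c'.2) c.2
    · exact absurd (this ▸ c.2) c'.2
    · rw [Subtype.ext this]

theorem exists_glueParents_eq {f : A → A ⊕ B} (hf : ∀ a, (f a).isRight ↔ a ∈ s) :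
    ∃ (g : s → B) (h : {a // a ∉ s} → {a // a ∉ s} ⊕ s), glueParents g h = f := by
  refine ⟨fun a => (f a).getRight ((hf a).2 a.2), fun a =>
    let c := (f a).getLeft (by simpa [← hf] using a.2)
    if hc : c ∈ s then Sum.inr ⟨c, hc⟩ else Sum.inl ⟨c, hc⟩, ?_⟩
  funext a
  by_cases ha : a ∈ s
  · simp [glueParents_of_mem _ _ ha]
  · rw [glueParents_of_notMem _ _ ha]
    dsimp only
    split_ifs <;> simp

theorem card_parentMap_fiber [Finite B] (s : Finset A) :
    Nat.card {f : ParentMap A B // ∀ a, (f.1 a).isRight ↔ a ∈ s} =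
      Nat.card B ^ s.card * Nat.card (ParentMap {a // a ∉ s} s) := by
  have e : Nat.card (s → B) = Nat.card B ^ s.card := by simp [Nat.card_fun]
  rw [← e, ← Nat.card_prod]
  symm
  refine Nat.card_congr (Equiv.ofBijective (fun p => ⟨⟨glueParents p.1 p.2.1,
    (forall_exits_glueParents _ _).2 p.2.2⟩, isRight_glueParents _ _⟩) ⟨?_, ?_⟩)
  · rintro ⟨g, h⟩ ⟨g', h'⟩ heq
    have := @glueParents_injective _ _ _ s (g, h.1) (g', h'.1)
      (congrArg Subtype.val (congrArg Subtype.val heq))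
    simp only [Prod.mk.injEq] at this
    exact Prod.ext this.1 (Subtype.ext this.2)
  · rintro ⟨⟨f, hE⟩, hf⟩
    obtain ⟨g, h, rfl⟩ := exists_glueParents_eq hf
    exact ⟨(g, ⟨h, (forall_exits_glueParents _ _).1 hE⟩), rfl⟩

/-- Sort parent maps by the set of vertices whose parent is a root. -/
theorem card_parentMap_filter [Fintype A] [Finite B] (p : ℕ → Prop) [DecidablePred p] :
    Nat.card {f : ParentMap A B // p (Finset.univ.filter fun a => (f.1 a).isRight).card} =
      ∑ s : Finset A with p s.card,
        Nat.card B ^ s.card * Nat.card (ParentMap {a // a ∉ s} s) := by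
  simp_rw [← card_parentMap_fiber]
  rw [← Finset.sum_coe_sort, ← Nat.card_sigma]
  refine Nat.card_congr
    { toFun := fun f => ⟨⟨Finset.univ.filter fun a => (f.1.1 a).isRight, by simpa using f.2⟩,
        f.1, by simp⟩
      invFun := fun x => ⟨x.2.1, by
        have h : (Finset.univ.filter fun a => (x.2.1.1 a).isRight) = x.1.1 := by
          ext a
          simp [x.2.2 a]
        rw [h]
        exact (Finset.mem_filter.1 x.1.2).2⟩
      left_inv := fun f => rfl
      right_inv := ?_ }
  rintro ⟨⟨s, hs⟩, f, hf⟩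
  obtain rfl : (Finset.univ.filter fun a => (f.1 a).isRight) = s := by
    ext a
    simp [hf a]
  rfl

end Decomposition

theorem card_parentMap_of_isEmpty (A B : Type) [IsEmpty A] : Nat.card (ParentMap A B) = 1 :=
  Nat.card_eq_one_iff_unique.2
    ⟨⟨fun _ _ => Subtype.ext (funext isEmptyElim)⟩, ⟨⟨isEmptyElim, isEmptyElim⟩⟩⟩

theorem card_parentMap_of_isEmpty_right (A B : Type) [Nonempty A] [IsEmpty B] :
    Nat.card (ParentMap A B) = 0 := by
  have : IsEmpty (ParentMap A B) := by
    refine ⟨fun f => ?_⟩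
    obtain ⟨a⟩ := ‹Nonempty A›
    induction f.2 a with
    | base h => exact isEmptyElim (α := B) (by assumption)
    | step _ _ ih => exact ih
  exact Nat.card_of_isEmpty

theorem sum_range_choose_mul_index (a b : ℕ) :
    ∑ j ∈ Finset.range (a + 2), (a + 1).choose j * (b ^ j * (j * (a + 1) ^ (a + 1 - j))) =
      (a + 1) * (b * (a + 1 + b) ^ a) := by
  rw [Finset.sum_range_succ']
  simp only [zero_mul, mul_zero, add_zero]
  rw [add_comm (a + 1) b, add_pow, Finset.mul_sum, Finset.mul_sum]
  refine Finset.sum_congr rfl fun j _ => ?_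
  have := Nat.add_one_mul_choose_eq a j
  rw [Nat.add_sub_add_right]
  calc _ = ((a + 1).choose (j + 1) * (j + 1)) * (b ^ (j + 1) * (a + 1) ^ (a - j)) := by ring
    _ = _ := by
      rw [← this, Nat.cast_id]
      ring

/-- The number of forests on `a + b` labelled vertices with `b` prescribed roots is
`b * (a + b) ^ (a - 1)`. -/
theorem card_parentMap (a : ℕ) : ∀ (A B : Type) [Finite A] [Finite B], Nat.card A = a →
    (a + Nat.card B) * Nat.card (ParentMap A B) = Nat.card B * (a + Nat.card B) ^ a := by
  classical
  induction a using Nat.strong_induction_on with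
  | _ a ih =>
  intro A B _ _ hA
  have := Fintype.ofFinite A
  rcases a with - | a
  · have : IsEmpty A := Finite.card_eq_zero_iff.1 hA
    simp [card_parentMap_of_isEmpty]
  have hne : Nonempty A := (Nat.card_pos_iff.1 (by omega)).1
  have hcard : Fintype.card A = a + 1 := by rw [← Nat.card_eq_fintype_card, hA]
  have hsum := card_parentMap_filter (A := A) (B := B) fun _ => True
  rw [Nat.card_congr (Equiv.subtypeUnivEquiv fun _ => trivial), Finset.filter_true] at hsum
  have hterm : ∀ s : Finset A, (a + 1) * Nat.card (ParentMap {a // a ∉ s} s) =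
      s.card * (a + 1) ^ (a + 1 - s.card) := by
    intro s
    have hs : s.card ≤ a + 1 := hcard ▸ s.card_le_univ
    have hc : Nat.card {a // a ∉ s} = a + 1 - s.card := by
      rw [Nat.card_eq_fintype_card, Fintype.card_subtype_compl, hcard, Fintype.card_coe]
    rcases s.eq_empty_or_nonempty with rfl | hne'
    · have : Nonempty {a // a ∉ (∅ : Finset A)} := ⟨⟨hne.some, by simp⟩⟩
      have : IsEmpty (∅ : Finset A) := Finset.isEmpty_coe_sort.2 rfl
      simp [card_parentMap_of_isEmpty_right]
    · have := ih (a + 1 - s.card) (by have := hne'.card_pos; omega) _ s hc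
      simpa [Nat.sub_add_cancel hs] using this
  have hmul : (a + 1) * Nat.card (ParentMap A B) =
      (a + 1) * (Nat.card B * (a + 1 + Nat.card B) ^ a) := by
    rw [← sum_range_choose_mul_index, hsum, Finset.mul_sum]
    simp_rw [mul_left_comm (a + 1), hterm]
    rw [← Finset.powerset_univ, Finset.sum_powerset_apply_card
      (fun j => Nat.card B ^ j * (j * (a + 1) ^ (a + 1 - j)))]
    simp [hcard]
  rw [Nat.eq_of_mul_eq_mul_left (Nat.succ_pos a) hmul]
  ring

section ParentGraph

open SimpleGraph

variable {A : Type}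

/-- The graph joining every vertex to its parent. -/
def parentGraph (f : A → A ⊕ Unit) : SimpleGraph (A ⊕ Unit) :=
  .fromRel fun x y => ∃ a, x = Sum.inl a ∧ f a = y

theorem Exits.apply_ne_self {f : A → A ⊕ Unit} {a : A} (h : Exits f a) : f a ≠ Sum.inl a := by
  induction h with
  | base h => simp [h]
  | step h _ ih =>
    intro h'
    obtain rfl := Sum.inl_injective (h.symm.trans h')
    exact ih h

theorem Exits.not_two_cycle {f : A → A ⊕ Unit} {a : A} (h : Exits f a) :
    ∀ a', f a = Sum.inl a' → f a' ≠ Sum.inl a := by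
  induction h with
  | base h => simp [h]
  | step h _ ih =>
    intro b hb hb'
    obtain rfl := Sum.inl_injective (h.symm.trans hb)
    exact ih _ hb' h

theorem parentGraph_adj_apply {f : A → A ⊕ Unit} {a : A} (h : Exits f a) :
    (parentGraph f).Adj (Sum.inl a) (f a) :=
  (fromRel_adj _ _ _).2 ⟨h.apply_ne_self.symm, .inl ⟨a, rfl, rfl⟩⟩

theorem parentGraph_adj_inl {f : A → A ⊕ Unit} {a : A} {y : A ⊕ Unit}
    (h : (parentGraph f).Adj (Sum.inl a) y) : f a = y ∨ ∃ b, y = Sum.inl b ∧ f b = Sum.inl a := by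
  obtain ⟨-, ⟨b, hb, rfl⟩ | h⟩ := (fromRel_adj _ _ _).1 h
  · exact .inl (by rw [Sum.inl_injective hb])
  · exact .inr h

theorem parentGraph_connected {f : A → A ⊕ Unit} (hf : ∀ a, Exits f a) :
    (parentGraph f).Connected := by
  refine connected_iff_exists_forall_reachable _ |>.2 ⟨Sum.inr (), ?_⟩
  rintro (a | ⟨⟩)
  · symm
    induction hf a with
    | base h => exact h ▸ (parentGraph_adj_apply (hf _)).reachable
    | step h _ ih => exact (h ▸ (parentGraph_adj_apply (hf _)).reachable).trans ih
  · rfl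

theorem parentGraph_isTree [Finite A] {f : A → A ⊕ Unit} (hf : ∀ a, Exits f a) :
    (parentGraph f).IsTree := by
  have hconn := parentGraph_connected hf
  refine isTree_iff_connected_and_card.2 ⟨hconn, le_antisymm ?_
    hconn.card_vert_le_card_edgeSet_add_one⟩
  have hsurj : Function.Surjective fun a : A =>
      (⟨s(Sum.inl a, f a), parentGraph_adj_apply (hf a)⟩ : (parentGraph f).edgeSet) := by
    rintro ⟨e, he⟩
    induction e with
    | _ x y =>
      obtain ⟨-, ⟨a, rfl, rfl⟩ | ⟨a, rfl, rfl⟩⟩ := (fromRel_adj _ _ _).1 ((mem_edgeSet _).1 he)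
      · exact ⟨a, rfl⟩
      · exact ⟨a, Subtype.ext Sym2.eq_swap⟩
  have := Nat.card_le_card_of_surjective _ hsurj
  rw [Nat.card_sum, Nat.card_unique (α := Unit)]
  exact Nat.add_le_add_right this 1

theorem parentGraph_injOn {f g : A → A ⊕ Unit} (hf : ∀ a, Exits f a)
    (h : parentGraph f = parentGraph g) : f = g := by
  funext a
  have hadj : ∀ a, (parentGraph g).Adj (Sum.inl a) (f a) :=
    fun a => h ▸ parentGraph_adj_apply (hf a)
  induction hf a with
  | @base a b hb =>
    rcases parentGraph_adj_inl (hadj a) with h' | ⟨c, hc, -⟩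
    · exact h'.symm
    · simp [hb] at hc
  | @step a a' hb _ ih =>
    rcases parentGraph_adj_inl (hadj a) with h' | ⟨c, hc, hc'⟩
    · exact h'.symm
    · obtain rfl := Sum.inl_injective (hb.symm.trans hc)
      exact absurd (ih.trans hc') ((hf a).not_two_cycle _ hb)

theorem SimpleGraph.Connected.exists_adj_dist_lt {V : Type*} {G : SimpleGraph V}
    (hG : G.Connected) {u v : V} (h : u ≠ v) : ∃ w, G.Adj u w ∧ G.dist w v < G.dist u v := by
  obtain ⟨p, hp⟩ := hG.exists_walk_length_eq_dist u v
  cases p with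
  | nil => exact absurd rfl h
  | @cons _ w _ hadj q =>
    exact ⟨w, hadj, by rw [← hp, Walk.length_cons]; exact Nat.lt_succ_of_le (dist_le q)⟩

theorem exists_parentGraph_eq {G : SimpleGraph (A ⊕ Unit)} (hG : G.IsTree) :
    ∃ f : A → A ⊕ Unit, (∀ a, Exits f a) ∧ parentGraph f = G := by
  choose f hadj hdist using fun a : A =>
    hG.connected.exists_adj_dist_lt (u := Sum.inl a) (v := Sum.inr ()) (by simp)
  have hE : ∀ n a, G.dist (Sum.inl a) (Sum.inr ()) < n → Exits f a := by
    intro n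
    induction n with
    | zero => simp
    | succ n ih =>
      intro a ha
      rcases h : f a with b | b
      · exact .step h (ih b (by have := hdist a; rw [h] at this; omega))
      · exact .base h
  have hf : ∀ a, Exits f a := fun a => hE _ a (Nat.lt_succ_self _)
  have hle : parentGraph f ≤ G := by
    intro x y hxy
    obtain ⟨-, ⟨a, rfl, rfl⟩ | ⟨a, rfl, rfl⟩⟩ := (fromRel_adj _ _ _).1 hxy
    · exact hadj a
    · exact (hadj a).symm
  exact ⟨f, hf, le_antisymm hle
    ((isTree_iff_minimal_connected.1 hG).2 (parentGraph_connected hf) hle)⟩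

theorem ncard_neighborSet_parentGraph [Fintype A] (f : A → A ⊕ Unit) :
    ((parentGraph f).neighborSet (Sum.inr ())).ncard =
      (Finset.univ.filter fun a => (f a).isRight).card := by
  have : (parentGraph f).neighborSet (Sum.inr ()) =
      Sum.inl '' ((Finset.univ.filter fun a => (f a).isRight : Finset A) : Set A) := by
    ext (a | u)
    · simp [parentGraph, Sum.isRight_iff, Unique.exists_iff]
    · simp [parentGraph]
  rw [this, Set.ncard_image_of_injective _ Sum.inl_injective, Set.ncard_coe_finset]

theorem card_trees_eq_card_parentMap [Fintype A] (d : ℕ) :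
    Nat.card {G : SimpleGraph (A ⊕ Unit) // G.IsTree ∧ (G.neighborSet (Sum.inr ())).ncard = d} =
      Nat.card {f : ParentMap A Unit //
        (Finset.univ.filter fun a => (f.1 a).isRight).card = d} := by
  symm
  refine Nat.card_congr (Equiv.ofBijective (fun f => ⟨parentGraph f.1.1,
    parentGraph_isTree f.1.2, (ncard_neighborSet_parentGraph _).trans f.2⟩) ⟨?_, ?_⟩)
  · intro f g h
    exact Subtype.ext (Subtype.ext (parentGraph_injOn f.1.2 (congrArg Subtype.val h)))
  · rintro ⟨G, hG, hd⟩
    obtain ⟨f, hf, rfl⟩ := exists_parentGraph_eq hG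
    exact ⟨⟨⟨f, hf⟩, (ncard_neighborSet_parentGraph _).symm.trans hd⟩, rfl⟩

theorem card_trees_transfer {V W : Type} (e : V ≃ W) (v : V) (d : ℕ) :
    Nat.card {G : SimpleGraph V // (G.Connected ∧ G.IsAcyclic) ∧ (G.neighborSet v).ncard = d} =
      Nat.card {G : SimpleGraph W // G.IsTree ∧ (G.neighborSet (e v)).ncard = d} := by
  refine Nat.card_congr (e.simpleGraph.subtypeEquiv fun G => ?_)
  let φ : e.simpleGraph G ≃g G := Iso.comap e.symm G
  have h : (e.simpleGraph G).neighborSet (e v) = e '' G.neighborSet v := by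
    ext w
    simp [Equiv.simpleGraph, e.image_eq_preimage_symm]
  rw [h, Set.ncard_image_of_injective _ e.injective, φ.isTree_iff, isTree_iff]

end ParentGraph

theorem card_trees_sum_unit (A : Type) [Fintype A] (k : ℕ) (hk : k < Fintype.card A) :
    Nat.card {G : SimpleGraph (A ⊕ Unit) //
        G.IsTree ∧ (G.neighborSet (Sum.inr ())).ncard = k + 1} =
      Fintype.card A ^ (Fintype.card A - k - 1) * (Fintype.card A - 1).choose k := by
  classical
  obtain ⟨m, hm⟩ : ∃ m, Fintype.card A = m + 1 := ⟨Fintype.card A - 1, by omega⟩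
  rw [card_trees_eq_card_parentMap, card_parentMap_filter (fun j => j = k + 1)]
  refine Nat.eq_of_mul_eq_mul_left (Nat.succ_pos m) ?_
  have hterm : ∀ s ∈ Finset.univ.filter (fun s : Finset A => s.card = k + 1),
      (m + 1) * (Nat.card Unit ^ s.card * Nat.card (ParentMap {a // a ∉ s} s)) =
        (k + 1) * (m + 1) ^ (m - k) := by
    intro s hs
    have hs : s.card = k + 1 := by simpa using hs
    have hc : Nat.card {a // a ∉ s} = m - k := by
      rw [Nat.card_eq_fintype_card, Fintype.card_subtype_compl, hm, Fintype.card_coe, hs,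
        Nat.add_sub_add_right]
    have := card_parentMap (m - k) _ s hc
    have hmk : m - k + (k + 1) = m + 1 := by omega
    simpa [hs, hmk] using this
  rw [Finset.mul_sum, Finset.sum_congr rfl hterm, Finset.sum_const, Finset.univ_filter_card_eq,
    Finset.card_powersetCard, Finset.card_univ, hm, smul_eq_mul, ← mul_assoc,
    ← Nat.add_one_mul_choose_eq]
  have : m + 1 - k - 1 = m - k := by omega
  rw [this, Nat.add_sub_cancel, Nat.succ_eq_add_one]
  ring

/-- For every `n ≥ 2` and `0 ≤ k ≤ n - 2`, the number of trees on the vertex set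
`{1, …, n}` in which the first vertex has degree exactly `k + 1` equals
`(n - 1) ^ (n - k - 2) * C(n - 2, k)`.  Trees are simple graphs on `Fin n` that are
connected and acyclic, and the degree of a vertex is the number of its neighbors. -/
theorem count_trees_with_given_degree_at_vertex (n k : ℕ) (hn : 2 ≤ n) (hk : k ≤ n - 2) :
    Nat.card {G : SimpleGraph (Fin n) //
        (G.Connected ∧ G.IsAcyclic) ∧ (G.neighborSet ⟨0, by omega⟩).ncard = k + 1} =
      (n - 1) ^ (n - k - 2) * (n - 2).choose k := by
  obtain ⟨m, rfl⟩ : ∃ m, n = m + 1 := ⟨n - 1, by omega⟩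
  let e : Fin (m + 1) ≃ Fin m ⊕ Unit := (finSuccEquiv m).trans (Equiv.optionEquivSumPUnit (Fin m))
  have he : e ⟨0, by omega⟩ = Sum.inr () := rfl
  rw [card_trees_transfer e, he, card_trees_sum_unit (Fin m) k (by rw [Fintype.card_fin]; omega),
    Fintype.card_fin]
  congr 2
  omega
end

section
/- For all integers n ≥ 1 and 1 ≤ k ≤ n, the number N of rooted forests with vertex set {1, …, n} and exactly k connected components satisfies n · N = k · C(n, k) · n^{n-k}; equivalently, for k ≤ n-1, N = k · C(n, k) · n^{n-k-1}. -/
namespace SimpleGraph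

variable {V : Type*} {G : SimpleGraph V} {R : Finset V}

/-- `R` contains exactly one vertex of each connected component of the acyclic graph `G`. -/
structure IsRootedForest (G : SimpleGraph V) (R : Finset V) : Prop where
  isAcyclic : G.IsAcyclic
  exists_root : ∀ x, ∃ r ∈ R, G.Reachable x r
  root_unique : ∀ r ∈ R, ∀ s ∈ R, G.Reachable r s → r = s

lemma isRootedForest_iff : G.IsRootedForest R ↔ G.IsAcyclic ∧
    ∀ c : G.ConnectedComponent, ∃! v : V, v ∈ R ∧ G.connectedComponentMk v = c := by
  constructor
  · rintro ⟨hG, hex, huniq⟩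
    refine ⟨hG, fun c ↦ ?_⟩
    induction c using ConnectedComponent.ind with | _ x
    obtain ⟨r, hr, hxr⟩ := hex x
    refine ⟨r, ⟨hr, ConnectedComponent.sound hxr.symm⟩, ?_⟩
    rintro s ⟨hs, hsx⟩
    exact huniq s hs r hr ((ConnectedComponent.exact hsx).trans hxr)
  · rintro ⟨hG, h⟩
    refine ⟨hG, fun x ↦ ?_, fun r hr s hs hrs ↦ ?_⟩
    · obtain ⟨r, ⟨hr, hrx⟩, -⟩ := h (G.connectedComponentMk x)
      exact ⟨r, hr, (ConnectedComponent.exact hrx).symm⟩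
    · exact (h (G.connectedComponentMk s)).unique ⟨hr, ConnectedComponent.sound hrs⟩ ⟨hs, rfl⟩

lemma Reachable.of_sup_edge {a b x y : V} (h : (G ⊔ edge a b).Reachable x y) :
    G.Reachable x y ∨ (G.Reachable x a ∧ G.Reachable b y) ∨
      (G.Reachable x b ∧ G.Reachable a y) := by
  obtain ⟨p⟩ := h
  induction p with
  | nil => exact .inl .rfl
  | cons hadj p ih =>
    rw [sup_adj, edge_adj] at hadj
    rcases hadj with hadj | ⟨⟨rfl, rfl⟩ | ⟨rfl, rfl⟩, -⟩
    · have := hadj.reachable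
      rcases ih with ih | ⟨h₁, h₂⟩ | ⟨h₁, h₂⟩
      · exact .inl (this.trans ih)
      · exact .inr (.inl ⟨this.trans h₁, h₂⟩)
      · exact .inr (.inr ⟨this.trans h₁, h₂⟩)
    · rcases ih with ih | ⟨h₁, h₂⟩ | ⟨h₁, h₂⟩
      · exact .inr (.inl ⟨.rfl, ih⟩)
      · exact .inr (.inl ⟨.rfl, h₂⟩)
      · exact .inl h₂
    · rcases ih with ih | ⟨h₁, h₂⟩ | ⟨h₁, h₂⟩
      · exact .inr (.inr ⟨.rfl, ih⟩)
      · exact .inl h₂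
      · exact .inr (.inr ⟨.rfl, h₂⟩)

/-- Reachability from a vertex `x` not connected to `s` is inherited by any graph that contains
all edges avoiding `s`. -/
lemma Reachable.of_forall_adj_ne {H : SimpleGraph V} {s x y : V} (h : G.Reachable x y)
    (hs : ¬ G.Reachable x s) (hGH : ∀ a b, a ≠ s → b ≠ s → G.Adj a b → H.Adj a b) :
    H.Reachable x y := by
  obtain ⟨p⟩ := h
  induction p with
  | nil => exact .rfl
  | @cons u v w hadj p ih =>
    have hv : ¬ G.Reachable v s := fun h ↦ hs (hadj.reachable.trans h)
    have hadj' := hGH u v (by rintro rfl; exact hs .rfl) (by rintro rfl; exact hv .rfl) hadj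
    exact hadj'.reachable.trans (ih hv)

namespace IsRootedForest

variable [DecidableEq V]

/-- Attaching the tree rooted at `s` to a vertex `v` of another tree. -/
lemma sup_edge (h : G.IsRootedForest R) {v s : V} (hs : s ∈ R) (hvs : ¬ G.Reachable v s) :
    (G ⊔ edge v s).IsRootedForest (R.erase s) where
  isAcyclic := h.isAcyclic.sup_edge_of_not_reachable hvs
  exists_root x := by
    obtain ⟨r, hr, hxr⟩ := h.exists_root x
    obtain ⟨t, ht, hvt⟩ := h.exists_root v
    have hle : G ≤ G ⊔ edge v s := le_sup_left
    by_cases hrs : r = s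
    · subst hrs
      refine ⟨t, Finset.mem_erase.2 ⟨?_, ht⟩, ?_⟩
      · rintro rfl
        exact hvs hvt
      · have hadj : (G ⊔ edge v r).Adj r v := by
          rw [sup_adj, edge_adj]
          exact .inr ⟨.inr ⟨rfl, rfl⟩, by rintro rfl; exact hvs .rfl⟩
        exact (hxr.mono hle).trans (hadj.reachable.trans (hvt.mono hle))
    · exact ⟨r, Finset.mem_erase.2 ⟨hrs, hr⟩, hxr.mono hle⟩
  root_unique r hr t ht hrt := by
    rw [Finset.mem_erase] at hr ht
    rcases hrt.of_sup_edge with hreach | ⟨-, hreach⟩ | ⟨hreach, -⟩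
    · exact h.root_unique r hr.2 t ht.2 hreach
    · exact absurd (h.root_unique s hs t ht.2 hreach).symm ht.1
    · exact absurd (h.root_unique r hr.2 s hs hreach) hr.1

/-- Every non-root vertex can be cut off from its parent. -/
lemma exists_eq_sup_edge (h : G.IsRootedForest R) {s : V} (hs : s ∉ R) :
    ∃ H : SimpleGraph V, ∃ v, H.IsRootedForest (insert s R) ∧ ¬ H.Reachable v s ∧
      H ⊔ edge v s = G := by
  obtain ⟨r, hr, hsr⟩ := h.exists_root s
  obtain ⟨p, hp⟩ := hsr.exists_isPath
  cases p with
  | nil => exact absurd hr hs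
  | @cons _ v _ hadj p =>
    rw [Walk.cons_isPath_iff] at hp
    have hbr := (isAcyclic_iff_forall_adj_isBridge.1 h.isAcyclic) hadj
    have hnr : ¬ (G.deleteEdges {s(s, v)}).Reachable s v := hbr
    have hsup : G.deleteEdges {s(s, v)} ⊔ edge v s = G := by
      ext a b
      simp only [sup_adj, deleteEdges_adj, edge_adj, Set.mem_singleton_iff, Sym2.eq_iff]
      have := hadj.symm
      have := hadj.ne
      grind
    set H := G.deleteEdges {s(s, v)} with hH
    have hle : H ≤ G := deleteEdges_le _
    have hvr : H.Reachable v r := by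
      refine ⟨p.toDeleteEdge s(s, v) fun he ↦ hp.2 (p.fst_mem_support_of_mem_edges he)⟩
    refine ⟨H, v, ⟨h.isAcyclic.anti hle, fun x ↦ ?_, ?_⟩, fun h' ↦ hnr h'.symm, hsup⟩
    · obtain ⟨t, ht, hxt⟩ := h.exists_root x
      rw [← hsup] at hxt
      rcases hxt.of_sup_edge with h' | ⟨h', -⟩ | ⟨h', -⟩
      · exact ⟨t, Finset.mem_insert_of_mem ht, h'⟩
      · exact ⟨r, Finset.mem_insert_of_mem hr, h'.trans hvr⟩
      · exact ⟨s, Finset.mem_insert_self _ _, h'⟩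
    · have key : ∀ t ∈ R, ¬ H.Reachable s t := fun t ht hst ↦ by
        have : t = r := h.root_unique t ht r hr ((hst.mono hle).symm.trans hsr)
        subst this
        exact hnr (hst.trans hvr.symm)
      intro a ha b hb hab
      rcases Finset.mem_insert.1 ha with has | haR <;> rcases Finset.mem_insert.1 hb with hbs | hbR
      · rw [has, hbs]
      · exact absurd (has ▸ hab) (key b hbR)
      · exact absurd (hbs ▸ hab.symm) (key a haR)
      · exact h.root_unique a haR b hbR (hab.mono hle)

/-- The parent of a vertex that has been attached is determined by the resulting graph. -/
lemma sup_edge_inj {H : SimpleGraph V} (hG : G.IsRootedForest R) (hH : H.IsRootedForest R)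
    {s v w : V} (hs : s ∈ R) (hv : ¬ G.Reachable v s) (hw : ¬ H.Reachable w s)
    (heq : G ⊔ edge v s = H ⊔ edge w s) : v = w ∧ G = H := by
  have hadj a b : (G ⊔ edge v s).Adj a b ↔ (H ⊔ edge w s).Adj a b := by rw [heq]
  simp only [sup_adj, edge_adj] at hadj
  have hws : w ≠ s := by rintro rfl; exact hw .rfl
  have hvs : v ≠ s := by rintro rfl; exact hv .rfl
  have hvw : v = w := by
    by_contra hne
    have hGw : G.Adj w s := by
      have := hadj w s
      grind
    obtain ⟨r, hr, hwr⟩ := hH.exists_root w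
    have hrs : r ≠ s := by rintro rfl; exact hw hwr
    have hwr' : G.Reachable w r := hwr.of_forall_adj_ne hw fun a b ha hb hab ↦ by
      have := hadj a b
      grind
    exact hrs (hG.root_unique r hr s hs (hwr'.symm.trans hGw.reachable))
  subst hvw
  refine ⟨rfl, ?_⟩
  have hG' : ¬ G.Adj v s := fun h ↦ hv h.reachable
  have hH' : ¬ H.Adj v s := fun h ↦ hw h.reachable
  ext a b
  have := hadj a b
  have := G.adj_comm v s
  have := H.adj_comm v s
  grind

end IsRootedForest

open scoped Classical in
/-- The rooted forests on `V` with `k` trees. -/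
noncomputable def rootedForests (V : Type*) [Fintype V] (k : ℕ) :
    Finset (SimpleGraph V × Finset V) :=
  {p | p.1.IsRootedForest p.2 ∧ p.2.card = k}

lemma mem_rootedForests [Fintype V] {k : ℕ} {p : SimpleGraph V × Finset V} :
    p ∈ rootedForests V k ↔ p.1.IsRootedForest p.2 ∧ p.2.card = k := by
  simp [rootedForests]

lemma card_rootedForests_card [Fintype V] : (rootedForests V (Fintype.card V)).card = 1 := by
  rw [Finset.card_eq_one]
  refine ⟨(⊥, Finset.univ), Finset.ext fun ⟨G, R⟩ ↦ ?_⟩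
  rw [mem_rootedForests, Finset.mem_singleton, Finset.card_eq_iff_eq_univ, Prod.mk.injEq]
  constructor
  · rintro ⟨h, hR : R = _⟩
    subst hR
    refine ⟨?_, rfl⟩
    ext a b
    simp only [bot_adj, iff_false]
    exact fun hab ↦ hab.ne (h.root_unique a (Finset.mem_univ _) b (Finset.mem_univ _) hab.reachable)
  · rintro ⟨rfl, rfl⟩
    refine ⟨⟨isAcyclic_bot, fun x ↦ ⟨x, Finset.mem_univ _, .rfl⟩, fun r _ s _ h ↦ ?_⟩, rfl⟩
    exact reachable_bot.1 h

lemma IsRootedForest.card_filter_not_reachable (h : G.IsRootedForest R) (v : V)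
    [DecidablePred fun s ↦ ¬ G.Reachable v s] :
    {s ∈ R | ¬ G.Reachable v s}.card = R.card - 1 := by
  classical
  obtain ⟨r, hr, hvr⟩ := h.exists_root v
  rw [← Finset.card_erase_of_mem hr]
  congr 1
  ext s
  rw [Finset.mem_filter, Finset.mem_erase, and_comm]
  refine and_congr_left fun hs ↦ not_congr ⟨fun hvs ↦ ?_, ?_⟩
  · exact h.root_unique s hs r hr (hvs.symm.trans hvr)
  · rintro rfl
    exact hvr

open scoped Classical in
/-- Double counting of the ways of attaching the root of one tree to a vertex of another one. -/
lemma card_rootedForests_succ_mul [Fintype V] (k : ℕ) :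
    (rootedForests V (k + 1)).card * (Fintype.card V * k) =
      (rootedForests V k).card * (Fintype.card V - k) := by
  have hA : ((rootedForests V (k + 1)).sigma fun p ↦ (Finset.univ : Finset V).sigma fun v ↦
      {s ∈ p.2 | ¬ p.1.Reachable v s}).card =
      (rootedForests V (k + 1)).card * (Fintype.card V * k) := by
    rw [Finset.card_sigma, Finset.sum_const_nat]
    intro p hp
    obtain ⟨hp, hk⟩ := mem_rootedForests.1 hp
    rw [Finset.card_sigma, Finset.sum_const_nat (m := k), Finset.card_univ]
    intro v _
    rw [hp.card_filter_not_reachable, hk, Nat.add_sub_cancel]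
  have hB : ((rootedForests V k).sigma fun p ↦ p.2ᶜ).card =
      (rootedForests V k).card * (Fintype.card V - k) := by
    rw [Finset.card_sigma, Finset.sum_const_nat]
    intro p hp
    rw [Finset.card_compl, (mem_rootedForests.1 hp).2]
  rw [← hA, ← hB]
  refine Finset.card_bij
    (fun x _ ↦ ⟨(x.1.1 ⊔ edge x.2.1 x.2.2, x.1.2.erase x.2.2), x.2.2⟩) ?_ ?_ ?_
  · rintro ⟨⟨G, R⟩, v, s⟩ h
    simp only [Finset.mem_sigma, mem_rootedForests, Finset.mem_univ, true_and,
      Finset.mem_filter] at h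
    obtain ⟨⟨hG, hk⟩, hs, hvs⟩ := h
    simp only [Finset.mem_sigma, mem_rootedForests, Finset.mem_compl, Finset.mem_erase]
    exact ⟨⟨hG.sup_edge hs hvs, by rw [Finset.card_erase_of_mem hs, hk, Nat.add_sub_cancel]⟩,
      by simp⟩
  · rintro ⟨⟨G, R⟩, v, s⟩ h ⟨⟨H, S⟩, w, t⟩ h' heq
    simp only [Finset.mem_sigma, mem_rootedForests, Finset.mem_univ, true_and,
      Finset.mem_filter] at h h'
    obtain ⟨⟨hG, -⟩, hs, hvs⟩ := h
    obtain ⟨⟨hH, -⟩, ht, hwt⟩ := h'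
    simp only [Sigma.mk.injEq, Prod.mk.injEq, heq_eq_eq] at heq
    obtain ⟨⟨hsup, hRS⟩, rfl⟩ := heq
    obtain rfl : R = S := by rw [← Finset.insert_erase hs, hRS, Finset.insert_erase ht]
    obtain ⟨rfl, rfl⟩ := hG.sup_edge_inj hH hs hvs hwt hsup
    rfl
  · rintro ⟨⟨G, R⟩, s⟩ h
    simp only [Finset.mem_sigma, mem_rootedForests, Finset.mem_compl] at h
    obtain ⟨⟨hG, hk⟩, hs⟩ := h
    obtain ⟨H, v, hH, hvs, hsup⟩ := hG.exists_eq_sup_edge hs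
    refine ⟨⟨(H, insert s R), v, s⟩, ?_, ?_⟩
    · simp only [Finset.mem_sigma, mem_rootedForests, Finset.mem_univ, true_and,
        Finset.mem_filter]
      exact ⟨⟨hH, by rw [Finset.card_insert_of_notMem hs, hk]⟩, Finset.mem_insert_self _ _, hvs⟩
    · simp [hsup, Finset.erase_insert hs]

lemma card_mul_card_rootedForests [Fintype V] {k : ℕ} (hk : k ≤ Fintype.card V) :
    Fintype.card V * (rootedForests V k).card =
      k * (Fintype.card V).choose k * Fintype.card V ^ (Fintype.card V - k) := by
  induction hk using Nat.decreasingInduction with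
  | self => simp [card_rootedForests_card]
  | of_succ k hk ih =>
    set n := Fintype.card V
    obtain ⟨m, hm⟩ := Nat.exists_eq_add_of_lt hk
    have hnk : n - k = m + 1 := by omega
    have hnk' : n - (k + 1) = m := by omega
    have hrec := card_rootedForests_succ_mul (V := V) k
    have hch := Nat.choose_succ_right_eq n k
    change _ * (n * k) = _ * (n - k) at hrec
    rw [hnk] at hrec hch ⊢
    rw [hnk'] at ih
    refine Nat.eq_of_mul_eq_mul_right (Nat.succ_pos m) ?_
    calc n * (rootedForests V k).card * (m + 1)
        = n * k * (n * (rootedForests V (k + 1)).card) := by rw [mul_assoc, ← hrec]; ring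
      _ = k * (n.choose (k + 1) * (k + 1)) * n ^ (m + 1) := by rw [ih]; ring
      _ = k * n.choose k * n ^ (m + 1) * (m + 1) := by rw [hch]; ring

end SimpleGraph


/-- The number `N` of rooted forests with vertex set `{1, …, n}` and exactly `k`
connected components satisfies `n * N = k * C(n, k) * n ^ (n - k)`.  A rooted forest
is a pair `(F, R)` where `F` is an acyclic simple graph on `Fin n` and `R` is a finite
set of vertices containing exactly one vertex in each connected component of `F`;
having exactly `k` components is expressed by `R.card = k`. -/
theorem count_rooted_forests (n k : ℕ) (hn : 1 ≤ n) (hk1 : 1 ≤ k) (hk : k ≤ n) :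
    n * Nat.card {p : SimpleGraph (Fin n) × Finset (Fin n) //
        p.1.IsAcyclic ∧
        (∀ c : p.1.ConnectedComponent, ∃! v : Fin n,
          v ∈ p.2 ∧ p.1.connectedComponentMk v = c) ∧
        p.2.card = k} =
      k * n.choose k * n ^ (n - k) := by
  have h := SimpleGraph.card_mul_card_rootedForests (V := Fin n) (k := k) (by simpa using hk)
  rw [Fintype.card_fin] at h
  rw [← h, ← Nat.card_eq_finsetCard]
  congr 1
  refine Nat.card_congr (Equiv.subtypeEquivRight fun p ↦ ?_)
  rw [SimpleGraph.mem_rootedForests, SimpleGraph.isRootedForest_iff, and_assoc]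
end

section
/- Let n ≥ 2 and let σ be an n-cycle in the symmetric group S_n (a permutation of {1, …, n} that is a single cycle moving all n points). Then the number of (n-1)-tuples (γ_1, …, γ_{n-1}) of transpositions in S_n with γ_1 γ_2 ⋯ γ_{n-1} = σ equals n^{n-2}. (Dénes' theorem on factorizations of an n-cycle into n-1 transpositions.) -/
namespace DenesTheorem

open Equiv Equiv.Perm

variable {α : Type*}

theorem _root_.Equiv.Perm.SameCycle.rel_of_rel_apply {π : Perm α} {r : α → α → Prop}
    (hr : Equivalence r) (h : ∀ x, r x (π x)) {x y : α} (hxy : π.SameCycle x y) : r x y := by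
  obtain ⟨i, rfl⟩ := hxy
  induction i with
  | zero => exact hr.refl x
  | succ i ih =>
    rw [add_comm, zpow_add, zpow_one, Perm.mul_apply]
    exact hr.trans ih (h _)
  | pred i ih =>
    refine hr.trans ih (hr.symm ?_)
    have := h ((π ^ (-(i : ℤ) - 1)) x)
    rwa [← Perm.mul_apply, ← zpow_one_add, add_sub_cancel] at this

/-- `R` contains exactly one point of each cycle of `π`, fixed points included. -/
structure IsCycleTransversal (π : Perm α) (R : Finset α) : Prop where
  exists_mem : ∀ x, ∃ r ∈ R, π.SameCycle x r
  eq_of_sameCycle : ∀ r ∈ R, ∀ s ∈ R, π.SameCycle r s → r = s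

theorem isCycleTransversal_one_iff [Fintype α] {R : Finset α} :
    IsCycleTransversal (1 : Perm α) R ↔ R = Finset.univ := by
  constructor
  · intro h
    ext x
    obtain ⟨r, hr, hxr⟩ := h.exists_mem x
    rw [sameCycle_one] at hxr
    simpa [hxr] using hr
  · rintro rfl
    exact ⟨fun x => ⟨x, by simp, SameCycle.refl _ _⟩, fun x _ y _ h => sameCycle_one.1 h⟩

open scoped Classical in
/-- The pairs of a permutation and a transversal of its cycles, when there are `n - k` of them. -/
noncomputable def rootedPerms (α : Type*) [Fintype α] (k : ℕ) : Finset (Perm α × Finset α) :=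
  Finset.univ.filter fun p => IsCycleTransversal p.1 p.2 ∧ p.2.card + k = Fintype.card α

theorem mem_rootedPerms [Fintype α] {k : ℕ} {p : Perm α × Finset α} : p ∈ rootedPerms α k ↔
    IsCycleTransversal p.1 p.2 ∧ p.2.card + k = Fintype.card α := by
  simp [rootedPerms]

variable [DecidableEq α]

theorem sameCycle_swap_mul_of_sameCycle_left [Finite α] {π : Perm α} {a b x : α}
    (hab : ¬ π.SameCycle a b) (h : π.SameCycle a x) : (swap a b * π).SameCycle a x := by
  obtain ⟨i, rfl⟩ := h.exists_nat_pow_eq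
  induction i with
  | zero => exact SameCycle.refl _ _
  | succ i ih =>
    have ih := ih (by simp [SameCycle.refl])
    by_cases ha : (π ^ (i + 1)) a = a
    · rw [ha]
    have hb : (π ^ (i + 1)) a ≠ b := fun hb => hab ⟨(i + 1 : ℕ), by rwa [zpow_natCast]⟩
    have : (swap a b * π) ((π ^ i) a) = (π ^ (i + 1)) a := by
      rw [Perm.mul_apply, ← Perm.mul_apply π, ← pow_succ', swap_apply_of_ne_of_ne ha hb]
    rw [← this]
    exact (sameCycle_apply_right).2 ih

theorem sameCycle_swap_mul_self [Finite α] {π : Perm α} {a b : α} (hab : ¬ π.SameCycle a b) :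
    (swap a b * π).SameCycle a b := by
  have h := sameCycle_swap_mul_of_sameCycle_left (x := π⁻¹ a) hab (by simp [SameCycle.refl])
  simpa using sameCycle_apply_right.2 h

theorem sameCycle_swap_mul_of_sameCycle_right [Finite α] {π : Perm α} {a b x : α}
    (hab : ¬ π.SameCycle a b) (h : π.SameCycle b x) : (swap a b * π).SameCycle b x := by
  rw [swap_comm]
  exact sameCycle_swap_mul_of_sameCycle_left (fun h => hab h.symm) h

theorem _root_.Equiv.Perm.SameCycle.swap_mul [Finite α] {π : Perm α} {a b x y : α}
    (hab : ¬ π.SameCycle a b) (h : π.SameCycle x y) : (swap a b * π).SameCycle x y := by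
  refine h.rel_of_rel_apply (SameCycle.equivalence _) fun z => ?_
  by_cases ha : π z = a
  · rw [ha]
    exact (sameCycle_swap_mul_of_sameCycle_left hab (by simp [← ha, SameCycle.refl])).symm
  by_cases hb : π z = b
  · rw [hb]
    exact (sameCycle_swap_mul_of_sameCycle_right hab (by simp [← hb, SameCycle.refl])).symm
  refine ⟨1, ?_⟩
  rw [zpow_one, Perm.mul_apply, swap_apply_of_ne_of_ne ha hb]

/-- Multiplying by a transposition of points in different cycles merges these two cycles. -/
theorem sameCycle_swap_mul_iff [Finite α] {π : Perm α} {a b x y : α}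
    (hab : ¬ π.SameCycle a b) : (swap a b * π).SameCycle x y ↔
      π.SameCycle x y ∨ π.SameCycle x a ∧ π.SameCycle y b ∨
        π.SameCycle x b ∧ π.SameCycle y a := by
  have hE := SameCycle.equivalence π
  constructor
  · intro h
    refine h.rel_of_rel_apply (r := fun x y => π.SameCycle x y ∨
      π.SameCycle x a ∧ π.SameCycle y b ∨ π.SameCycle x b ∧ π.SameCycle y a)
      ⟨fun x => Or.inl (hE.refl x), ?_, ?_⟩ ?_
    · intro x y h
      have := @hE.symm
      grind
    · intro x y z h h'
      have := @hE.symm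
      have := @hE.trans
      grind
    · intro z
      by_cases ha : π z = a
      · right; left
        simp [← ha, SameCycle.refl]
      by_cases hb : π z = b
      · right; right
        simp [← hb, SameCycle.refl]
      left
      simp [swap_apply_of_ne_of_ne ha hb, SameCycle.refl]
  · have h' := sameCycle_swap_mul_self hab
    rintro (h | ⟨h₁, h₂⟩ | ⟨h₁, h₂⟩)
    · exact h.swap_mul hab
    · exact ((h₁.swap_mul hab).trans h').trans (h₂.swap_mul hab).symm
    · exact ((h₁.swap_mul hab).trans h'.symm).trans (h₂.swap_mul hab).symm

theorem not_sameCycle_swap_mul_self [Finite α] {π : Perm α} {a b : α} (hne : a ≠ b)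
    (hab : π.SameCycle a b) : ¬ (swap a b * π).SameCycle a b := by
  classical
  have hex := hab.exists_nat_pow_eq
  have hj := Nat.find_spec hex
  have hmin := fun m => Nat.find_min hex (m := m)
  generalize Nat.find hex = j at hj hmin
  have hinv : ∀ k, ∃ i < j, ((swap a b * π) ^ k) a = (π ^ i) a := by
    intro k
    induction k with
    | zero =>
      refine ⟨0, Nat.pos_of_ne_zero ?_, rfl⟩
      rintro rfl
      exact hne hj
    | succ k ih =>
      obtain ⟨i, hi, hk⟩ := ih
      rw [pow_succ', Perm.mul_apply, hk, Perm.mul_apply, ← Perm.mul_apply π, ← pow_succ']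
      rcases Nat.lt_or_ge (i + 1) j with hlt | hge
      · refine ⟨i + 1, hlt, swap_apply_of_ne_of_ne (fun h => ?_) (hmin _ hlt)⟩
        refine hmin (j - (i + 1)) (by omega) ?_
        rw [← hj]
        conv_rhs => rw [← Nat.sub_add_cancel hlt.le, pow_add, Perm.mul_apply, h]
      · obtain rfl : j = i + 1 := by omega
        exact ⟨0, by omega, by simp [hj]⟩
  intro h
  obtain ⟨k, hk⟩ := h.exists_nat_pow_eq
  obtain ⟨i, hi, hki⟩ := hinv k
  exact hmin i hi (hki.symm.trans hk)

theorem IsCycleTransversal.erase [Finite α] {π : Perm α} {R : Finset α}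
    (h : IsCycleTransversal π R) {a b r : α} (hr : r ∈ R) (hbr : π.SameCycle b r)
    (hab : ¬ π.SameCycle a b) : IsCycleTransversal (swap a b * π) (R.erase r) := by
  obtain ⟨s, hs, has⟩ := h.exists_mem a
  have hsr : s ≠ r := by
    rintro rfl
    exact hab (has.trans hbr.symm)
  constructor
  · intro x
    obtain ⟨t, ht, hxt⟩ := h.exists_mem x
    by_cases htr : t = r
    · subst htr
      exact ⟨s, Finset.mem_erase.2 ⟨hsr, hs⟩,
        (sameCycle_swap_mul_iff hab).2 (Or.inr (Or.inr ⟨hxt.trans hbr.symm, has.symm⟩))⟩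
    · exact ⟨t, Finset.mem_erase.2 ⟨htr, ht⟩, hxt.swap_mul hab⟩
  · intro x hx y hy hxy
    rw [Finset.mem_erase] at hx hy
    rcases (sameCycle_swap_mul_iff hab).1 hxy with h₁ | ⟨-, h₂⟩ | ⟨h₂, -⟩
    · exact h.eq_of_sameCycle x hx.2 y hy.2 h₁
    · exact (hy.1 (h.eq_of_sameCycle y hy.2 r hr (h₂.trans hbr))).elim
    · exact (hx.1 (h.eq_of_sameCycle x hx.2 r hr (h₂.trans hbr))).elim

/-- If the cycle of `a` and `b` is split, the representative of its half containing `a` is kept and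
`b` represents the other half. -/
theorem IsCycleTransversal.insert_right [Finite α] {π : Perm α} {R : Finset α} {a b r : α}
    (hab : ¬ π.SameCycle a b) (h : IsCycleTransversal (swap a b * π) R) (hr : r ∈ R)
    (har : π.SameCycle a r) : b ∉ R ∧ IsCycleTransversal π (insert b R) := by
  have key : ∀ s ∈ R, ¬ π.SameCycle b s := by
    intro s hs hbs
    have hrs : (swap a b * π).SameCycle r s :=
      (sameCycle_swap_mul_iff hab).2 (Or.inr (Or.inl ⟨har.symm, hbs.symm⟩))
    obtain rfl := h.eq_of_sameCycle r hr s hs hrs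
    exact hab (har.trans hbs.symm)
  refine ⟨fun hb => key b hb (SameCycle.refl _ _), ?_, ?_⟩
  · intro x
    obtain ⟨s, hs, hxs⟩ := h.exists_mem x
    rcases (sameCycle_swap_mul_iff hab).1 hxs with h₁ | ⟨h₁, h₂⟩ | ⟨h₁, -⟩
    · exact ⟨s, Finset.mem_insert_of_mem hs, h₁⟩
    · exact ⟨r, Finset.mem_insert_of_mem hr, h₁.trans har⟩
    · exact ⟨b, Finset.mem_insert_self _ _, h₁⟩
  · intro x hx y hy hxy
    rw [Finset.mem_insert] at hx hy
    rcases hx with rfl | hx <;> rcases hy with rfl | hy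
    · rfl
    · exact (key y hy hxy).elim
    · exact (key x hx hxy.symm).elim
    · exact h.eq_of_sameCycle x hx y hy (hxy.swap_mul hab)

theorem IsCycleTransversal.exists_insert [Finite α] {π : Perm α} {R : Finset α} {a b : α}
    (h : IsCycleTransversal π R) (hne : a ≠ b) (hab : π.SameCycle a b) :
    ∃ v r, swap v r = swap a b ∧ r ∉ R ∧ ¬ (swap a b * π).SameCycle v r ∧
      IsCycleTransversal (swap a b * π) (insert r R) := by
  have hab' := not_sameCycle_swap_mul_self hne hab
  obtain ⟨r, hr, har⟩ := h.exists_mem a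
  rw [← swap_mul_self_mul a b π] at h har
  rcases (sameCycle_swap_mul_iff hab').1 har with h₁ | ⟨-, h₁⟩ | ⟨h₁, -⟩
  · obtain ⟨hb, h₂⟩ := IsCycleTransversal.insert_right hab' h hr h₁
    exact ⟨a, b, rfl, hb, hab', h₂⟩
  · have hba' := fun h => hab' (SameCycle.symm h)
    obtain ⟨ha, h₂⟩ := IsCycleTransversal.insert_right hba' (by rwa [swap_comm b a]) hr h₁.symm
    exact ⟨b, a, swap_comm _ _, ha, hba', h₂⟩
  · exact (hab' h₁).elim

theorem IsCycleTransversal.card_filter_not_sameCycle {π : Perm α} {R : Finset α}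
    [DecidableRel π.SameCycle] (h : IsCycleTransversal π R) (v : α) :
    (R.filter fun r => ¬ π.SameCycle v r).card = R.card - 1 := by
  obtain ⟨s, hs, hvs⟩ := h.exists_mem v
  rw [← Finset.card_erase_of_mem hs]
  congr 1
  ext r
  rw [Finset.mem_filter, Finset.mem_erase, and_comm]
  refine and_congr_left fun hr => ⟨?_, ?_⟩
  · rintro hvr rfl
    exact hvr hvs
  · exact fun hrs hvr => hrs (h.eq_of_sameCycle r hr s hs (hvr.symm.trans hvs))

theorem IsCycleTransversal.eq_of_erase_eq [Finite α] {π : Perm α} {R R' : Finset α}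
    {v r v' r' : α} (h : IsCycleTransversal π R) (h' : IsCycleTransversal π R') (hr : r ∈ R)
    (hr' : r' ∈ R') (hvr : ¬ π.SameCycle v r) (hR : R.erase r = R'.erase r')
    (hs : swap v r = swap v' r') : v = v' ∧ r = r' ∧ R = R' := by
  have hne : v ≠ r := fun h => hvr (h ▸ SameCycle.refl _ _)
  have key : r' ≠ v := by
    rintro rfl
    obtain ⟨s, hs, hvs⟩ := h.exists_mem r'
    have hsr : s ≠ r := by
      rintro rfl
      exact hvr hvs
    have hs' := Finset.mem_erase.2 ⟨hsr, hs⟩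
    rw [hR, Finset.mem_erase] at hs'
    exact hs'.1 (h'.eq_of_sameCycle s hs'.2 r' hr' hvs.symm)
  have hv : r = swap v' r' v := by rw [← hs, swap_apply_left]
  have hv' : v = v' := by
    by_contra hvv'
    rw [swap_apply_of_ne_of_ne hvv' key.symm] at hv
    exact hne hv.symm
  subst hv'
  rw [swap_apply_left] at hv
  subst hv
  refine ⟨rfl, rfl, ?_⟩
  rw [← Finset.insert_erase hr, hR, Finset.insert_erase hr']

variable [Fintype α]

open scoped Classical in
/-- The number of ways to write `π` as a product of `k` transpositions. -/
noncomputable def swapWordCount : ℕ → Perm α → ℕ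
  | 0, π => if π = 1 then 1 else 0
  | k + 1, π => ∑ t : Perm α with t.IsSwap, swapWordCount k (t * π)

open scoped Classical in
theorem card_swap_words (k : ℕ) (π : Perm α) :
    Nat.card {γ : Fin k → Perm α // (∀ i, (γ i).IsSwap) ∧ (List.ofFn γ).prod = π} =
      swapWordCount k π := by
  induction k generalizing π with
  | zero =>
    rw [swapWordCount]
    split_ifs with h
    · subst h
      rw [Nat.card_eq_one_iff_unique]
      exact ⟨⟨fun _ _ => Subtype.ext (Subsingleton.elim _ _)⟩, ⟨![], by simp⟩⟩
    · have : IsEmpty {γ : Fin 0 → Perm α // (∀ i, (γ i).IsSwap) ∧ (List.ofFn γ).prod = π} :=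
        ⟨fun γ => h (by simpa using γ.2.2.symm)⟩
      exact Nat.card_of_isEmpty
  | succ k ih =>
    rw [swapWordCount, Finset.sum_congr rfl fun t _ => (ih (t * π)).symm]
    have e : {γ : Fin (k + 1) → Perm α // (∀ i, (γ i).IsSwap) ∧ (List.ofFn γ).prod = π} ≃
        Σ t : {t : Perm α // t.IsSwap}, {γ : Fin k → Perm α //
          (∀ i, (γ i).IsSwap) ∧ (List.ofFn γ).prod = t * π} :=
      { toFun := fun γ => ⟨⟨γ.1 0, γ.2.1 0⟩, Fin.tail γ.1, fun i => γ.2.1 i.succ, by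
          obtain ⟨x, y, -, h⟩ := γ.2.1 0
          have h' := γ.2.2
          rw [List.ofFn_succ, List.prod_cons] at h'
          refine Eq.trans ?_ (congrArg (γ.1 0 * ·) h')
          simp only [h, swap_mul_self_mul]
          rfl⟩
        invFun := fun p => ⟨Fin.cons p.1.1 p.2.1, by
          refine ⟨Fin.cases p.1.2 p.2.2.1, ?_⟩
          obtain ⟨x, y, -, h⟩ := p.1.2
          simp [List.ofFn_succ, p.2.2.2, h]⟩
        left_inv := fun γ => Subtype.ext (Fin.cons_self_tail _)
        right_inv := fun p => rfl }
    rw [Nat.card_congr e, Nat.card_sigma, ← Finset.sum_subtype_eq_sum_filter]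
    simp

open scoped Classical in
theorem swapWordCount_conj (k : ℕ) (g π : Perm α) :
    swapWordCount k (g * π * g⁻¹) = swapWordCount k π := by
  induction k generalizing π with
  | zero => simp [swapWordCount]
  | succ k ih =>
    simp only [swapWordCount]
    refine (Finset.sum_equiv (MulAut.conj g).toEquiv (fun t => ?_) fun t _ => ?_).symm
    · simp only [Finset.mem_filter, Finset.mem_univ, true_and]
      constructor
      · rintro ⟨x, y, hxy, rfl⟩
        exact ⟨g x, g y, g.injective.ne hxy, (swap_apply_apply g x y).symm⟩
      · rintro ⟨x, y, hxy, h⟩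
        refine ⟨g⁻¹ x, g⁻¹ y, (g⁻¹).injective.ne hxy, ?_⟩
        rw [swap_apply_apply, ← h]
        simp [mul_assoc]
    · rw [← ih]
      simp [mul_assoc]

open scoped Classical in
/-- A product of `k` transpositions has at least `n - k` cycles. -/
theorem IsCycleTransversal.card_le_card_add {k : ℕ} {π : Perm α} {R : Finset α}
    (h : IsCycleTransversal π R) (hk : swapWordCount k π ≠ 0) :
    Fintype.card α ≤ R.card + k := by
  induction k generalizing π R with
  | zero =>
    obtain rfl : π = 1 := by simpa [swapWordCount] using hk
    simp [isCycleTransversal_one_iff.1 h]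
  | succ k ih =>
    rw [swapWordCount] at hk
    obtain ⟨t, ht, htk⟩ := Finset.exists_ne_zero_of_sum_ne_zero hk
    obtain ⟨a, b, hne, rfl⟩ := (Finset.mem_filter.1 ht).2
    by_cases hab : π.SameCycle a b
    · obtain ⟨v, r, -, hr, -, h₂⟩ := h.exists_insert hne hab
      have := ih h₂ htk
      rw [Finset.card_insert_of_notMem hr] at this
      lia
    · obtain ⟨r, hr, hbr⟩ := h.exists_mem b
      have := ih (h.erase hr hbr hab) htk
      have := Finset.card_erase_le (s := R) (a := r)
      lia

open scoped Classical in
theorem sum_rootedPerms_succ (k : ℕ) :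
    ∑ p ∈ rootedPerms α (k + 1), swapWordCount (k + 1) p.1 =
      Fintype.card α * (Fintype.card α - k - 1) *
        ∑ p ∈ rootedPerms α k, swapWordCount k p.1 := by
  simp only [swapWordCount]
  rw [← Finset.sum_product' (rootedPerms α (k + 1)) (Finset.univ.filter fun t : Perm α => t.IsSwap)
    fun p t => swapWordCount k (t * p.1), Finset.mul_sum]
  have hcard : ∀ p ∈ rootedPerms α k,
      Fintype.card α * (Fintype.card α - k - 1) * swapWordCount k p.1 =
        ∑ q ∈ Finset.univ.sigma fun v => p.2.filter fun r => ¬ p.1.SameCycle v r,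
          swapWordCount k p.1 := by
    intro p hp
    obtain ⟨h, hc⟩ := mem_rootedPerms.1 hp
    rw [Finset.sum_const, Finset.card_sigma,
      Finset.sum_congr rfl fun v _ => h.card_filter_not_sameCycle v, Finset.sum_const,
      Finset.card_univ, smul_eq_mul, smul_eq_mul, ← hc, Nat.add_sub_cancel]
  rw [Finset.sum_congr rfl hcard,
    ← Finset.sum_sigma _ _ fun x : (_ : Perm α × Finset α) × (_ : α) × α => swapWordCount k x.1.1]
  symm
  refine Finset.sum_of_injOn
    (fun x => ((swap x.2.1 x.2.2 * x.1.1, x.1.2.erase x.2.2), swap x.2.1 x.2.2)) ?_ ?_ ?_ ?_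
  · rintro ⟨⟨π, R⟩, v, r⟩ hx ⟨⟨π', R'⟩, v', r'⟩ hx' he
    simp only [Finset.coe_sigma, Set.mem_sigma_iff, Finset.mem_coe, mem_rootedPerms,
      Finset.mem_univ, Finset.mem_filter, true_and] at hx hx'
    simp only [Prod.mk.injEq] at he
    obtain ⟨⟨hπ, hR⟩, hs⟩ := he
    rw [hs, mul_right_inj] at hπ
    subst hπ
    obtain ⟨rfl, rfl, rfl⟩ := hx.1.1.eq_of_erase_eq hx'.1.1 hx.2.1 hx'.2.1 hx.2.2 hR hs
    rfl
  · rintro ⟨⟨π, R⟩, v, r⟩ hx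
    simp only [Finset.coe_sigma, Set.mem_sigma_iff, Finset.mem_coe, mem_rootedPerms,
      Finset.mem_univ, Finset.mem_filter, true_and] at hx
    obtain ⟨⟨h, hc⟩, hr, hvr⟩ := hx
    simp only [Finset.mem_coe, Finset.mem_product, mem_rootedPerms, Finset.mem_filter,
      Finset.mem_univ, true_and]
    refine ⟨⟨h.erase hr (SameCycle.refl _ _) hvr, ?_⟩, v, r, ?_, rfl⟩
    · have := Finset.card_erase_add_one hr
      lia
    · rintro rfl
      exact hvr (SameCycle.refl _ _)
  · rintro ⟨⟨π, R⟩, t⟩ hx hnot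
    simp only [Finset.mem_product, mem_rootedPerms, Finset.mem_filter,
      Finset.mem_univ, true_and] at hx
    obtain ⟨⟨h, hc⟩, a, b, hne, rfl⟩ := hx
    by_contra hk
    by_cases hab : π.SameCycle a b
    · obtain ⟨v, r, hs, hr, hvr, h₂⟩ := h.exists_insert hne hab
      refine hnot ⟨⟨(swap a b * π, insert r R), v, r⟩, ?_, ?_⟩
      · simp only [Finset.mem_coe, mem_rootedPerms, Finset.mem_sigma, Finset.mem_univ,
          Finset.mem_filter, true_and]
        refine ⟨⟨h₂, ?_⟩, Finset.mem_insert_self _ _, hvr⟩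
        rw [Finset.card_insert_of_notMem hr]
        lia
      · simp only [hs, swap_mul_self_mul, Finset.erase_insert hr]
    · obtain ⟨r, hr, hbr⟩ := h.exists_mem b
      have := (h.erase hr hbr hab).card_le_card_add hk
      have := Finset.card_erase_add_one hr
      lia
  · rintro ⟨⟨π, R⟩, v, r⟩ -
    simp only [swap_mul_self_mul]

theorem sum_rootedPerms (m k : ℕ) (h : Fintype.card α = m + 1 + k) :
    m.factorial * ∑ p ∈ rootedPerms α k, swapWordCount k p.1 =
      Fintype.card α ^ k * (m + k).factorial := by
  induction k generalizing m with
  | zero =>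
    rw [Finset.sum_eq_single (1, Finset.univ)]
    · simp [swapWordCount]
    · rintro ⟨π, R⟩ hp hne
      refine if_neg ?_
      rintro rfl
      exact hne (Prod.ext rfl (isCycleTransversal_one_iff.1 (mem_rootedPerms.1 hp).1))
    · intro h
      exact (h (mem_rootedPerms.2 ⟨isCycleTransversal_one_iff.2 rfl, by simp⟩)).elim
  | succ k ih =>
    have h₁ := ih (m + 1) (by lia)
    have h₂ : Fintype.card α - k - 1 = m + 1 := by lia
    rw [Nat.factorial_succ, show m + 1 + k = m + (k + 1) by ring] at h₁
    rw [sum_rootedPerms_succ, h₂, pow_succ', mul_assoc, mul_assoc _ (_ ^ k), ← h₁]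
    ring

theorem isCycleTransversal_singleton_iff (hα : 2 ≤ Fintype.card α) {π : Perm α} {x : α} :
    IsCycleTransversal π {x} ↔ π.cycleType = {Fintype.card α} := by
  have : Nontrivial α := Fintype.one_lt_card_iff_nontrivial.1 hα
  constructor
  · intro h
    have hsame : ∀ y z, π.SameCycle y z := by
      intro y z
      obtain ⟨r, hr, hyr⟩ := h.exists_mem y
      obtain ⟨s, hs, hzs⟩ := h.exists_mem z
      rw [Finset.mem_singleton] at hr hs
      subst hr hs
      exact hyr.trans hzs.symm
    have hmoved : ∀ y, π y ≠ y := by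
      intro y hy
      obtain ⟨z, hz⟩ := exists_ne y
      exact hz ((hsame y z).eq_of_left hy).symm
    have hcyc : π.IsCycle := ⟨x, hmoved x, fun y _ => hsame x y⟩
    rw [hcyc.cycleType, Finset.eq_univ_of_forall fun y => mem_support.2 (hmoved y),
      Finset.card_univ]
  · intro h
    have hcyc : π.IsCycle := by
      rw [← card_cycleType_eq_one, h, Multiset.card_singleton]
    have hsupp : π.support = Finset.univ := by
      rw [← Finset.card_eq_iff_eq_univ, ← sum_cycleType, h, Multiset.sum_singleton]
    have hmoved : ∀ y, π y ≠ y := fun y => mem_support.1 (by simp [hsupp])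
    refine ⟨fun y => ⟨x, by simp, hcyc.sameCycle (hmoved y) (hmoved x)⟩, ?_⟩
    intro r hr s hs _
    rw [Finset.mem_singleton.1 hr, Finset.mem_singleton.1 hs]

theorem swapWordCount_of_cycleType (hα : 2 ≤ Fintype.card α) {σ : Perm α}
    (hσ : σ.cycleType = {Fintype.card α}) :
    swapWordCount (Fintype.card α - 1) σ = Fintype.card α ^ (Fintype.card α - 2) := by
  have hsum : ∑ p ∈ (Finset.univ.filter fun π : Perm α => π.cycleType = {Fintype.card α}) ×ˢ
      (Finset.univ : Finset α), swapWordCount (Fintype.card α - 1) σ =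
        ∑ p ∈ rootedPerms α (Fintype.card α - 1), swapWordCount (Fintype.card α - 1) p.1 := by
    refine Finset.sum_nbij (fun p => (p.1, {p.2})) ?_ ?_ ?_ ?_
    · rintro ⟨π, x⟩ hp
      simp only [Finset.mem_product, Finset.mem_filter, Finset.mem_univ, true_and, and_true] at hp
      refine mem_rootedPerms.2 ⟨(isCycleTransversal_singleton_iff hα).2 hp, ?_⟩
      rw [Finset.card_singleton]
      lia
    · rintro ⟨π, x⟩ - ⟨π', x'⟩ - h
      simpa using h
    · rintro ⟨π, R⟩ hp
      obtain ⟨h, hc⟩ := mem_rootedPerms.1 hp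
      obtain ⟨x, rfl⟩ : ∃ x, R = {x} := Finset.card_eq_one.1 (by dsimp only at hc; lia)
      refine ⟨(π, x), ?_, rfl⟩
      simpa using (isCycleTransversal_singleton_iff hα).1 h
    · rintro ⟨π, x⟩ hp
      simp only [Finset.mem_product, Finset.mem_filter, Finset.mem_univ, true_and, and_true] at hp
      obtain ⟨g, rfl⟩ := isConj_iff.1 (isConj_iff_cycleType_eq.2 (hσ.trans hp.symm))
      exact (swapWordCount_conj _ _ _).symm
  have key := sum_rootedPerms (α := α) 0 (Fintype.card α - 1) (by lia)
  rw [← hsum, Finset.sum_const, Finset.card_product, card_of_cycleType_singleton hα le_rfl,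
    Finset.card_univ, Nat.choose_self, Nat.factorial_zero, one_mul, mul_one, zero_add,
    smul_eq_mul, show Fintype.card α - 1 = Fintype.card α - 2 + 1 by lia, pow_succ] at key
  refine Nat.eq_of_mul_eq_mul_left
    (Nat.mul_pos (Nat.factorial_pos (Fintype.card α - 2 + 1)) (by lia : 0 < Fintype.card α)) ?_
  rw [show Fintype.card α - 1 = Fintype.card α - 2 + 1 by lia, key]
  ring

end DenesTheorem

/-- **Dénes' theorem.** Let `n ≥ 2` and let `σ` be an `n`-cycle in the symmetric group
on `n` letters (a single cycle moving all `n` points, i.e. its support is everything).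
Then the number of `(n-1)`-tuples `(γ 1, …, γ (n-1))` of transpositions whose product,
taken in the indicated order, is `σ`, equals `n ^ (n - 2)`. -/
theorem denes_factorizations_of_cycle (n : ℕ) (hn : 2 ≤ n) (σ : Equiv.Perm (Fin n))
    (hσ : σ.IsCycle) (hsupp : σ.support = Finset.univ) :
    Nat.card {γ : Fin (n - 1) → Equiv.Perm (Fin n) //
        (∀ i, (γ i).IsSwap) ∧ (List.ofFn γ).prod = σ} = n ^ (n - 2) := by
  have hcard : σ.cycleType = {Fintype.card (Fin n)} := by
    rw [hσ.cycleType, hsupp, Finset.card_univ]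
  rw [DenesTheorem.card_swap_words]
  simpa using DenesTheorem.swapWordCount_of_cycleType (by simpa using hn) hcard
end

section
/- Let σ be a permutation in S_d, let μ be the cycle type of σ (the multiset of lengths, each ≥ 2, of the nontrivial cycles of σ), and set k = (sum of the parts of μ) − (number of parts of μ). Let N be the number of k-tuples (γ_1, …, γ_k) of transpositions in S_d with γ_1 ⋯ γ_k = σ. Then (∏_{m ∈ μ} m!) · N = k! · ∏_{m ∈ μ} m^{m-1}; equivalently N = k! · ∏_{m ∈ μ} m^{m-1}/m!. (Counting minimal factorizations of a permutation into transpositions, cycle by cycle.) -/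
namespace TranspositionCount

open Finset

section Abel

open Polynomial

theorem abel_sum_zero (n : ℕ) (hn : n ≠ 0) :
    ∑ a ∈ range (n + 1), ((n + 1).choose (a + 1) : ℚ) * (a + 1 : ℚ) ^ a *
      (-(a + 1 : ℚ)) ^ (n - a) = 0 := by
  have h := congrFun (fwdDiff_iter_pow_eq_zero_of_lt (R := ℚ) (Nat.lt_succ_self n)) 0
  rw [fwdDiff_iter_eq_sum_shift, sum_range_succ'] at h
  simp only [zero_add, nsmul_eq_mul, mul_one, Nat.cast_zero, zero_pow hn, smul_zero, add_zero,
    Pi.zero_apply, zsmul_eq_mul] at h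
  rw [← h]
  refine sum_congr rfl fun a ha => ?_
  have ha : a ≤ n := by simpa [Nat.lt_succ_iff] using ha
  rw [neg_pow, Nat.succ_sub_succ]
  obtain ⟨b, rfl⟩ := Nat.exists_eq_add_of_le ha
  push_cast
  simp only [Nat.add_sub_cancel_left]
  ring

theorem abel_polynomial (n : ℕ) :
    ∑ a ∈ range (n + 1), C (((n + 1).choose (a + 1) : ℚ) * (a + 1 : ℚ) ^ a) *
      (X - C (a + 1 : ℚ)) ^ (n - a) = C (n + 1 : ℚ) * X ^ n := by
  induction n with
  | zero => simp
  | succ n ih =>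
    rw [← sub_eq_zero]
    set p : ℚ[X] := _ - _ with hp
    have hd : derivative p = 0 := by
      rw [hp, derivative_sub, derivative_sum, sum_range_succ, derivative_C_mul_X_pow]
      have := congrArg (C (n + 2 : ℚ) * ·) ih
      simp only [mul_sum] at this
      rw [sub_eq_zero]
      simp only [Nat.sub_self, pow_zero, mul_one, derivative_C, add_zero]
      trans C (n + 2 : ℚ) * (C (n + 1 : ℚ) * X ^ n)
      · rw [← this]
        refine sum_congr rfl fun a ha => ?_
        have ha : a ≤ n := by simpa [Nat.lt_succ_iff] using ha
        rw [derivative_C_mul, derivative_X_sub_C_pow, ← mul_assoc, ← C_mul,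
          ← mul_assoc, ← C_mul]
        have h1 := Nat.choose_mul_succ_eq (n + 1) (a + 1)
        obtain ⟨b, rfl⟩ := Nat.exists_eq_add_of_le ha
        rw [show a + b + 1 + 1 - (a + 1) = b + 1 by omega] at h1
        rw [show a + b + 1 - a = b + 1 by omega, Nat.add_sub_cancel, Nat.add_sub_cancel_left]
        have h2 := congrArg (Nat.cast (R := ℚ)) h1
        push_cast at h2 ⊢
        congr 2
        linear_combination (-(a + 1 : ℚ) ^ a) * h2
      · rw [← mul_assoc, ← C_mul, Nat.add_sub_cancel]
        congr 2
        push_cast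
        ring
    have h0 : p.eval 0 = 0 := by
      rw [hp, eval_sub, eval_finsetSum]
      simpa using abel_sum_zero (n + 1) (Nat.succ_ne_zero n)
    rw [eq_C_of_natDegree_eq_zero (derivative_eq_zero.1 hd)] at h0 ⊢
    simpa using h0

/-- The normalized number `m ^ (m - 1) / m!` of minimal factorizations of an `m`-cycle. -/
def cycleWeight (m : ℕ) : ℚ := (m : ℚ) ^ (m - 1) / m.factorial

theorem mul_cycleWeight (m : ℕ) (hm : m ≠ 0) : m * cycleWeight m = (m : ℚ) ^ m / m.factorial := by
  rw [cycleWeight, ← mul_div_assoc, mul_pow_sub_one hm]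

theorem sum_cycleWeight_mul_mul (n : ℕ) :
    ∑ a ∈ range n, cycleWeight (a + 1) * cycleWeight (n - a) * ((n - a : ℕ) : ℚ) =
      n * cycleWeight (n + 1) := by
  have h := congrArg (fun p => eval (n + 1 : ℚ) p / (n + 1).factorial) (abel_polynomial n)
  simp only [eval_finsetSum, sum_div] at h
  rw [sum_range_succ] at h
  have key : ∀ a ∈ range n, cycleWeight (a + 1) * cycleWeight (n - a) * ((n - a : ℕ) : ℚ) =
      eval (n + 1 : ℚ) (C (((n + 1).choose (a + 1) : ℚ) * (a + 1 : ℚ) ^ a) *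
      (X - C (a + 1 : ℚ)) ^ (n - a)) / (n + 1).factorial := by
    intro a ha
    have ha : a < n := by simpa using ha
    rw [mul_assoc, mul_comm (cycleWeight (n - a)), mul_cycleWeight _ (by omega), cycleWeight,
      Nat.cast_choose ℚ (by omega : a + 1 ≤ n + 1), Nat.add_sub_add_right]
    have e : (n : ℚ) + 1 - (a + 1) = ((n - a : ℕ) : ℚ) := by
      rw [Nat.cast_sub ha.le]; ring
    have := Nat.factorial_ne_zero
    simp only [eval_mul, eval_C, eval_pow, eval_sub, eval_X, e]
    push_cast
    have h1 : ((n + 1).factorial : ℚ) ≠ 0 := by exact_mod_cast this _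
    have h2 : ((a + 1).factorial : ℚ) ≠ 0 := by exact_mod_cast this _
    have h3 : ((n - a).factorial : ℚ) ≠ 0 := by exact_mod_cast this _
    field_simp
    simp
  rw [sum_congr rfl key]
  rw [← eq_sub_iff_add_eq] at h
  rw [h, cycleWeight]
  simp
  ring

theorem sum_cycleWeight_mul (n : ℕ) :
    ∑ a ∈ range n, cycleWeight (a + 1) * cycleWeight (n - a) =
      2 * n / (n + 1) * cycleWeight (n + 1) := by
  have h1 := sum_cycleWeight_mul_mul n
  have h2 := h1
  rw [← sum_range_reflect] at h2
  have h3 : (n + 1 : ℚ) * ∑ a ∈ range n, cycleWeight (a + 1) * cycleWeight (n - a) =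
      2 * n * cycleWeight (n + 1) := by
    rw [mul_assoc, two_mul]
    nth_rewrite 1 [← h1]
    rw [← h2, ← sum_add_distrib, mul_sum]
    refine sum_congr rfl fun a ha => ?_
    have ha : a < n := by simpa using ha
    rw [show n - 1 - a + 1 = n - a by omega, show n - (n - 1 - a) = a + 1 by omega,
      Nat.cast_sub ha.le]
    push_cast
    ring
  field_simp
  linarith

end Abel

open Equiv Equiv.Perm

/-- The multiset `{n}` with the parts `0` and `1` discarded. -/
def nontrivialPart (n : ℕ) : Multiset ℕ := if n < 2 then 0 else {n}

section TranspositionFactorizations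

variable {α : Type*} [DecidableEq α]

theorem formPerm_append_cons (l₁ l₂ : List α) (x y : α) (h : (x :: l₁ ++ y :: l₂).Nodup) :
    (x :: l₁ ++ y :: l₂).formPerm = swap x y * ((x :: l₁).formPerm * (y :: l₂).formPerm) := by
  induction l₁ generalizing x with
  | nil => simp
  | cons z l₁ ih =>
    have hz := (List.nodup_cons.1 h).2
    have hzy : z ≠ y := by
      rintro rfl
      simp at hz
    have hxz : x ≠ z := by
      rintro rfl
      simp at h
    have hxy : x ≠ y := by
      rintro rfl
      simp at h
    have e : swap x z * swap z y = swap x y * swap x z := by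
      rw [mul_swap_eq_swap_mul, swap_apply_right, swap_apply_of_ne_of_ne hxy.symm hzy.symm]
    have := ih z hz
    simp only [List.cons_append] at this ⊢
    rw [List.formPerm_cons_cons, this, List.formPerm_cons_cons x z, ← mul_assoc, e]
    simp only [mul_assoc]

variable [Fintype α]

theorem cycleType_formPerm_eq (l : List α) (h : l.Nodup) :
    l.formPerm.cycleType = nontrivialPart l.length := by
  unfold nontrivialPart
  split_ifs with hl
  · rw [(List.formPerm_eq_one_iff l h).2 (by omega), cycleType_one]
  · have hl : 2 ≤ l.length := by omega
    rw [(List.isCycle_formPerm h hl).cycleType, List.support_formPerm_of_nodup l h,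
      List.toFinset_card_of_nodup h]
    rintro x rfl
    simp at hl

theorem cycleType_swap_mul (σ : Perm α) (i : α) (a : ℕ) (ha : 0 < a)
    (ha' : a < #(σ.cycleOf i).support) :
    ∃ R, σ.cycleType = #(σ.cycleOf i).support ::ₘ R ∧
      (swap i ((σ ^ a) i) * σ).cycleType =
        nontrivialPart a + nontrivialPart (#(σ.cycleOf i).support - a) + R := by
  have hi : i ∈ σ.support := by
    rw [mem_support, ← support_cycleOf_nonempty, ← card_pos]; omega
  have hc := cycleOf_mem_cycleFactorsFinset_iff.2 hi
  have hd := disjoint_mul_inv_of_mem_cycleFactorsFinset hc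
  set c := σ.cycleOf i with hcdef
  set r := σ * c⁻¹ with hr
  have hσ : σ = c * r := by rw [← hd.commute.eq]; simp [hr]
  have hcc : c.cycleType = {#c.support} := (mem_cycleFactorsFinset_iff.1 hc).1.cycleType
  have hlen : (σ.toList i).length = #c.support := length_toList σ i
  have hnd := nodup_toList σ i
  have hform : (σ.toList i).formPerm = c := formPerm_toList σ i
  obtain ⟨x, l₁, h₁⟩ := List.exists_cons_of_ne_nil (l := (σ.toList i).take a)
    (by rw [← List.length_pos_iff, List.length_take]; omega)
  obtain ⟨y, l₂, h₂⟩ := List.exists_cons_of_ne_nil (l := (σ.toList i).drop a)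
    (by rw [← List.length_pos_iff, List.length_drop]; omega)
  have hl : x :: l₁ ++ y :: l₂ = σ.toList i := by rw [← h₁, ← h₂, List.take_append_drop]
  have hx : x = i := by
    have : (σ.toList i)[0]? = some x := by rw [← hl]; simp
    rw [List.getElem?_eq_getElem (by omega), getElem_toList] at this
    simpa using this.symm
  have hla : (x :: l₁).length = a := by rw [← h₁, List.length_take]; omega
  have hlb : (y :: l₂).length = #c.support - a := by rw [← h₂, List.length_drop]; omega
  have hy : y = (σ ^ a) i := by
    have : (σ.toList i)[a]? = some y := by
      rw [← hl, List.getElem?_append_right hla.le, hla]; simp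
    rw [List.getElem?_eq_getElem (by omega), getElem_toList] at this
    simpa using this.symm
  rw [← hl] at hnd
  have hsplit := formPerm_append_cons l₁ l₂ x y hnd
  rw [hl, hform] at hsplit
  obtain ⟨n₁, n₂, n₃⟩ := List.nodup_append'.1 hnd
  have d₁ : Perm.Disjoint (x :: l₁).formPerm (y :: l₂).formPerm := by
    rw [disjoint_iff_disjoint_support]
    exact (List.disjoint_toFinset_iff_disjoint.2 n₃).mono (List.support_formPerm_le _)
      (List.support_formPerm_le _)
  have hsupp : c.support = (x :: l₁ ++ y :: l₂).toFinset := by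
    rw [hl, ← hform, List.support_formPerm_of_nodup _ (nodup_toList σ i) (toList_ne_singleton σ i)]
  have d₂ : Perm.Disjoint ((x :: l₁).formPerm * (y :: l₂).formPerm) r := by
    rw [disjoint_iff_disjoint_support]
    refine (disjoint_iff_disjoint_support.1 hd.symm).mono_left ?_
    rw [hsupp, List.toFinset_append]
    exact (support_mul_le _ _).trans (union_subset_union (List.support_formPerm_le _)
      (List.support_formPerm_le _))
  refine ⟨r.cycleType, ?_, ?_⟩
  · conv_lhs => rw [hσ, hd.symm.cycleType_mul, hcc]
    rfl
  · rw [← hy, ← hx]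
    have : swap x y * σ = (x :: l₁).formPerm * (y :: l₂).formPerm * r := by
      conv_lhs => rw [hσ, hsplit]
      simp only [← mul_assoc, swap_mul_self, one_mul]
    rw [this, d₂.cycleType_mul, d₁.cycleType_mul, cycleType_formPerm_eq _ n₁,
      cycleType_formPerm_eq _ n₂, hla, hlb]

theorem sameCycle_swap_mul (σ : Perm α) (i j : α) (h : ¬ σ.SameCycle i j) :
    (swap i j * σ).SameCycle i j := by
  have hex : ∃ m, 0 < m ∧ (σ ^ m) i = i := ⟨orderOf σ, orderOf_pos σ, by simp [pow_orderOf_eq_one]⟩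
  obtain ⟨hm, hmi⟩ := Nat.find_spec hex
  have hmin := fun t => Nat.find_min hex (m := t)
  set m := Nat.find hex
  have key : ∀ t, t < m → ((swap i j * σ) ^ t) i = (σ ^ t) i := by
    intro t
    induction t with
    | zero => simp
    | succ t ih =>
      intro ht
      rw [pow_succ', Perm.mul_apply, ih (by omega), Perm.mul_apply, ← Perm.mul_apply σ,
        ← pow_succ']
      apply swap_apply_of_ne_of_ne
      · exact fun e => hmin _ ht ⟨t.succ_pos, e⟩
      · rintro rfl
        exact h ⟨(t + 1 : ℕ), by rw [zpow_natCast]⟩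
  obtain ⟨s, hs⟩ := Nat.exists_eq_succ_of_ne_zero hm.ne'
  refine ⟨(s + 1 : ℕ), ?_⟩
  rw [zpow_natCast, pow_succ', Perm.mul_apply, key s (by omega), Perm.mul_apply,
    ← Perm.mul_apply σ, ← pow_succ', ← Nat.succ_eq_add_one, ← hs, hmi, swap_apply_left]

theorem card_offDiag_swap_eq (τ : Perm α) (hτ : τ.IsSwap) :
    #{p ∈ (univ : Finset α).offDiag | swap p.1 p.2 = τ} = 2 := by
  obtain ⟨x, y, hxy, rfl⟩ := hτ
  have : {p ∈ (univ : Finset α).offDiag | swap p.1 p.2 = swap x y} = {(x, y), (y, x)} := by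
    ext ⟨p, q⟩
    simp only [mem_filter, mem_offDiag, mem_univ, true_and, mem_insert, mem_singleton,
      Prod.mk.injEq]
    constructor
    · rintro ⟨hpq, h⟩
      have h1 := congrArg (· p) h
      have h2 := congrArg (· q) h
      simp only [swap_apply_left, swap_apply_right, swap_apply_def] at h1 h2
      grind
    · rintro (⟨rfl, rfl⟩ | ⟨rfl, rfl⟩)
      · exact ⟨hxy, rfl⟩
      · exact ⟨hxy.symm, swap_comm _ _⟩
  rw [this, card_pair]
  simp [hxy]

open scoped Classical in
theorem two_mul_sum_isSwap (g : Perm α → ℚ) :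
    2 * ∑ τ : Perm α with τ.IsSwap, g τ = ∑ i, ∑ j ∈ univ.erase i, g (swap i j) := by
  have h1 : ∑ p ∈ (univ : Finset α).offDiag, g (swap p.1 p.2) =
      ∑ i, ∑ j ∈ univ.erase i, g (swap i j) := by
    rw [sum_sigma']
    refine sum_nbij' (fun p => ⟨p.1, p.2⟩) (fun p => (p.1, p.2)) ?_ ?_ ?_ ?_ ?_ <;>
      simp [eq_comm]
  rw [← h1, ← sum_fiberwise_of_maps_to (g := fun p : α × α => swap p.1 p.2)
    (t := {τ : Perm α | τ.IsSwap}), mul_sum]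
  · refine sum_congr rfl fun τ hτ => ?_
    rw [sum_congr rfl (g := fun _ => g τ), sum_const, card_offDiag_swap_eq τ (by simpa using hτ)]
    · simp
    · intro p hp
      rw [(mem_filter.1 hp).2]
  · rintro ⟨x, y⟩ h
    simp only [mem_filter, mem_univ, true_and]
    exact ⟨x, y, by simpa using h, rfl⟩

/-- The number of factorizations of `σ` as an ordered product of `n` transpositions. -/
noncomputable def swapFactorizations (n : ℕ) (σ : Perm α) : ℕ :=
  Nat.card {γ : Fin n → Perm α // (∀ i, (γ i).IsSwap) ∧ (List.ofFn γ).prod = σ}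

theorem swapFactorizations_zero (σ : Perm α) :
    swapFactorizations 0 σ = if σ = 1 then 1 else 0 := by
  unfold swapFactorizations
  split_ifs with h
  · subst h
    simp
  · simp [Ne.symm h]

open scoped Classical in
theorem swapFactorizations_succ (n : ℕ) (σ : Perm α) :
    swapFactorizations (n + 1) σ = ∑ τ : Perm α with τ.IsSwap, swapFactorizations n (τ * σ) := by
  have inv {τ : Perm α} (h : τ.IsSwap) : τ * τ = 1 := by
    obtain ⟨x, y, -, rfl⟩ := h
    exact swap_mul_self x y
  let e : {γ : Fin (n + 1) → Perm α // (∀ i, (γ i).IsSwap) ∧ (List.ofFn γ).prod = σ} ≃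
      Σ τ : {τ : Perm α // τ.IsSwap},
        {γ : Fin n → Perm α // (∀ i, (γ i).IsSwap) ∧ (List.ofFn γ).prod = τ * σ} :=
    { toFun γ := ⟨⟨γ.1 0, γ.2.1 0⟩, ⟨fun i => γ.1 i.succ, fun i => γ.2.1 _, by
        have h := congrArg (γ.1 0 * ·) γ.2.2
        simpa [List.ofFn_succ, ← mul_assoc, inv (γ.2.1 0)] using h⟩⟩
      invFun p := ⟨Fin.cons p.1.1 p.2.1, Fin.cases p.1.2 p.2.2.1, by
        simp only [List.ofFn_succ, List.prod_cons, Fin.cons_zero, Fin.cons_succ]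
        rw [p.2.2.2, ← mul_assoc, inv p.1.2, one_mul]⟩
      left_inv γ := Subtype.ext (Fin.cons_self_tail γ.1)
      right_inv p := rfl }
  rw [swapFactorizations, Nat.card_congr e, Nat.card_sigma]
  exact (sum_subtype _ (by simp) (fun τ => swapFactorizations n (τ * σ))).symm

theorem sum_map_sub_one_nontrivialPart (n : ℕ) :
    ((nontrivialPart n).map (· - 1)).sum = n - 1 := by
  unfold nontrivialPart
  split_ifs
  · simp; omega
  · simp

theorem prod_map_cycleWeight_nontrivialPart (n : ℕ) :
    ((nontrivialPart n).map cycleWeight).prod = cycleWeight n := by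
  unfold nontrivialPart
  split_ifs with h
  · interval_cases n <;> simp [cycleWeight]
  · simp

theorem cycleWeight_ne_zero (n : ℕ) : cycleWeight n ≠ 0 := by
  rcases n with - | n
  · simp [cycleWeight]
  · unfold cycleWeight
    positivity

/-- The minimal number of transpositions whose product is `σ`. -/
def swapLength (σ : Perm α) : ℕ := (σ.cycleType.map (· - 1)).sum

/-- The product of the cycle weights of `σ`. -/
def permWeight (σ : Perm α) : ℚ := (σ.cycleType.map cycleWeight).prod

theorem swapLength_swap_mul_pow (σ : Perm α) (i : α) (a : ℕ) (ha : 0 < a)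
    (ha' : a < #(σ.cycleOf i).support) :
    swapLength (swap i ((σ ^ a) i) * σ) + 1 = swapLength σ := by
  obtain ⟨R, h, h'⟩ := cycleType_swap_mul σ i a ha ha'
  simp only [swapLength, h, h', Multiset.map_add, Multiset.sum_add, Multiset.map_cons,
    Multiset.sum_cons, sum_map_sub_one_nontrivialPart]
  omega

theorem permWeight_swap_mul_pow (σ : Perm α) (i : α) (a : ℕ) (ha : 0 < a)
    (ha' : a < #(σ.cycleOf i).support) :
    permWeight (swap i ((σ ^ a) i) * σ) = permWeight σ / cycleWeight #(σ.cycleOf i).support *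
      (cycleWeight a * cycleWeight (#(σ.cycleOf i).support - a)) := by
  obtain ⟨R, h, h'⟩ := cycleType_swap_mul σ i a ha ha'
  have := cycleWeight_ne_zero #(σ.cycleOf i).support
  simp only [permWeight, h, h', Multiset.map_add, Multiset.prod_add, Multiset.map_cons,
    Multiset.prod_cons, prod_map_cycleWeight_nontrivialPart]
  field_simp

theorem SameCycle.exists_pow_pos_lt {σ : Perm α} {i j : α} (hij : i ≠ j) (h : σ.SameCycle i j) :
    ∃ a, 0 < a ∧ a < #(σ.cycleOf i).support ∧ (σ ^ a) i = j := by
  have hi : i ∈ σ.support := by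
    by_contra hi
    obtain ⟨n, hn⟩ := h
    exact hij ((zpow_apply_eq_self_of_apply_eq_self (notMem_support.1 hi) n).symm.trans hn)
  obtain ⟨a, ha, rfl⟩ := h.exists_pow_eq_of_mem_support hi
  refine ⟨a, Nat.pos_of_ne_zero ?_, ha, rfl⟩
  rintro rfl
  simp at hij

theorem swapLength_swap_mul_of_sameCycle {σ : Perm α} {i j : α} (hij : i ≠ j)
    (h : σ.SameCycle i j) : swapLength (swap i j * σ) + 1 = swapLength σ := by
  obtain ⟨a, ha, ha', rfl⟩ := SameCycle.exists_pow_pos_lt hij h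
  exact swapLength_swap_mul_pow σ i a ha ha'

theorem swapLength_swap_mul_of_not_sameCycle {σ : Perm α} {i j : α} (hij : i ≠ j)
    (h : ¬ σ.SameCycle i j) : swapLength (swap i j * σ) = swapLength σ + 1 := by
  have := swapLength_swap_mul_of_sameCycle hij (sameCycle_swap_mul σ i j h)
  rw [swap_mul_self_mul] at this
  exact this.symm

theorem eq_one_of_swapLength_eq_zero {σ : Perm α} (h : swapLength σ = 0) : σ = 1 := by
  rw [← cycleType_eq_zero, Multiset.eq_zero_iff_forall_notMem]
  intro n hn
  have h2 := two_le_of_mem_cycleType hn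
  have h1 := Multiset.sum_eq_zero_iff.1 h (n - 1) (Multiset.mem_map_of_mem _ hn)
  omega

theorem swapFactorizations_eq_zero (n : ℕ) (σ : Perm α) (h : n < swapLength σ) :
    swapFactorizations n σ = 0 := by
  classical
  induction n generalizing σ with
  | zero =>
    rw [swapFactorizations_zero, if_neg]
    rintro rfl
    simp [swapLength] at h
  | succ n ih =>
    rw [swapFactorizations_succ]
    refine sum_eq_zero fun τ hτ => ih _ ?_
    obtain ⟨i, j, hij, rfl⟩ := (mem_filter.1 hτ).2
    by_cases hs : σ.SameCycle i j
    · have := swapLength_swap_mul_of_sameCycle hij hs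
      omega
    · have := swapLength_swap_mul_of_not_sameCycle hij hs
      omega

theorem sum_erase_eq_sum_range_pow (σ : Perm α) (i : α) (g : α → ℚ)
    (hg : ∀ j, ¬ σ.SameCycle i j → g j = 0) :
    ∑ j ∈ univ.erase i, g j = ∑ a ∈ range (#(σ.cycleOf i).support - 1), g ((σ ^ (a + 1)) i) := by
  have hmem {a : ℕ} (ha : a ∈ range (#(σ.cycleOf i).support - 1)) :
      i ∈ (σ.cycleOf i).support := by
    have : 0 < #(σ.cycleOf i).support := by
      have := mem_range.1 ha
      omega
    rw [mem_support_cycleOf_iff, mem_support]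
    exact ⟨SameCycle.refl _ _, support_cycleOf_nonempty.1 (card_pos.1 this)⟩
  have hc := isCycleOn_support_cycleOf σ i
  symm
  refine sum_of_injOn (fun a => (σ ^ (a + 1)) i) ?_ ?_ ?_ ?_
  · intro a ha b hb hab
    have := (hc.pow_apply_eq_pow_apply (hmem ha)).1 hab
    simp only [coe_range, Set.mem_Iio] at ha hb
    have := this.eq_of_lt_of_lt (by omega) (by omega)
    omega
  · intro a ha
    simp only [coe_erase, coe_univ, Set.mem_sdiff, Set.mem_univ, true_and, Set.mem_singleton_iff]
    rw [hc.pow_apply_eq (hmem ha)]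
    intro h
    have := Nat.le_of_dvd a.succ_pos h
    simp only [coe_range, Set.mem_Iio] at ha
    omega
  · intro j hj hj'
    apply hg
    intro hs
    obtain ⟨a, ha, ha', rfl⟩ := SameCycle.exists_pow_pos_lt (ne_of_mem_erase hj).symm hs
    refine hj' ⟨a - 1, ?_, ?_⟩
    · simp only [coe_range, Set.mem_Iio]
      omega
    · simp only
      rw [Nat.sub_add_cancel ha]
  · simp

theorem sum_card_support_cycleOf (σ : Perm α) :
    ∑ i, ((#(σ.cycleOf i).support - 1 : ℕ) : ℚ) / #(σ.cycleOf i).support = swapLength σ := by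
  rw [← sum_subset (subset_univ σ.support), ← sum_fiberwise_of_maps_to (g := σ.cycleOf)
    (t := σ.cycleFactorsFinset) fun i hi => cycleOf_mem_cycleFactorsFinset_iff.2 hi]
  · rw [swapLength, cycleType_def, Multiset.map_map, Nat.cast_multiset_sum, Multiset.map_map]
    refine sum_congr rfl fun c hc => ?_
    have hfib : {i ∈ σ.support | σ.cycleOf i = c} = c.support := by
      ext i
      rw [mem_filter]
      constructor
      · rintro ⟨hi, rfl⟩
        exact mem_support_cycleOf_iff.2 ⟨SameCycle.refl _ _, hi⟩
      · intro hi
        exact ⟨mem_cycleFactorsFinset_support_le hc hi, (cycle_is_cycleOf hi hc).symm⟩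
    have hpos : (#c.support : ℚ) ≠ 0 := by
      have := (mem_cycleFactorsFinset_iff.1 hc).1.two_le_card_support
      exact_mod_cast (by omega : #c.support ≠ 0)
    rw [sum_congr rfl (g := fun _ => ((#c.support - 1 : ℕ) : ℚ) / #c.support), hfib, sum_const,
      nsmul_eq_mul, mul_div_cancel₀ _ hpos]
    · rfl
    · intro i hi
      rw [(mem_filter.1 hi).2]
  · intro i _ hi
    rw [(cycleOf_eq_one_iff σ).2 (notMem_support.1 hi)]
    simp

theorem swapFactorizations_eq (n : ℕ) (σ : Perm α) (h : swapLength σ = n) :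
    (swapFactorizations n σ : ℚ) = n.factorial * permWeight σ := by
  classical
  induction n generalizing σ with
  | zero =>
    rw [eq_one_of_swapLength_eq_zero h, swapFactorizations_zero]
    simp [permWeight]
  | succ n ih =>
    have h2 := two_mul_sum_isSwap fun τ : Perm α => (swapFactorizations n (τ * σ) : ℚ)
    rw [← Nat.cast_sum, ← swapFactorizations_succ] at h2
    have key (i : α) : ∑ j ∈ univ.erase i, (swapFactorizations n (swap i j * σ) : ℚ) =
        2 * n.factorial * permWeight σ *
          (((#(σ.cycleOf i).support - 1 : ℕ) : ℚ) / #(σ.cycleOf i).support) := by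
      rw [sum_erase_eq_sum_range_pow σ i fun j => (swapFactorizations n (swap i j * σ) : ℚ)]
      · rcases hm : #(σ.cycleOf i).support with - | m
        · simp
        · have hw := cycleWeight_ne_zero (m + 1)
          have hterm : ∀ a ∈ range m,
              (swapFactorizations n (swap i ((σ ^ (a + 1)) i) * σ) : ℚ) =
              n.factorial * (permWeight σ / cycleWeight (m + 1)) *
                (cycleWeight (a + 1) * cycleWeight (m - a)) := by
            intro a ha
            have ha' : a + 1 < #(σ.cycleOf i).support := by
              have := mem_range.1 ha
              omega
            have hl := swapLength_swap_mul_pow σ i (a + 1) a.succ_pos ha'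
            rw [ih _ (by omega), permWeight_swap_mul_pow σ i (a + 1) a.succ_pos ha', hm,
              Nat.add_sub_add_right, mul_assoc]
          rw [Nat.add_sub_cancel, sum_congr rfl hterm, ← mul_sum, sum_cycleWeight_mul]
          push_cast
          field_simp
      · intro j hj
        have hij : i ≠ j := by
          rintro rfl
          exact hj (SameCycle.refl _ _)
        have := swapLength_swap_mul_of_not_sameCycle hij hj
        rw [swapFactorizations_eq_zero n _ (by omega), Nat.cast_zero]
    rw [sum_congr rfl fun i _ => key i, ← mul_sum, sum_card_support_cycleOf, h] at h2
    rw [Nat.factorial_succ]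
    push_cast at h2 ⊢
    linarith

theorem swapLength_eq_sum_sub_card (σ : Perm α) :
    swapLength σ = σ.cycleType.sum - σ.cycleType.card := by
  have h : ∀ s : Multiset ℕ, (∀ n ∈ s, 2 ≤ n) → (s.map (· - 1)).sum + s.card = s.sum := by
    intro s
    induction s using Multiset.induction with
    | empty => simp
    | cons a s ih =>
      intro hs
      have h1 := ih fun n hn => hs n (Multiset.mem_cons_of_mem hn)
      have h2 := hs a (Multiset.mem_cons_self a s)
      simp only [Multiset.map_cons, Multiset.sum_cons, Multiset.card_cons]
      omega
  have := h σ.cycleType fun n hn => two_le_of_mem_cycleType hn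
  rw [swapLength]
  omega

theorem prod_factorial_mul_permWeight (σ : Perm α) :
    ((σ.cycleType.map Nat.factorial).prod : ℚ) * permWeight σ =
      ((σ.cycleType.map fun m => m ^ (m - 1)).prod : ℕ) := by
  rw [permWeight, Nat.cast_multiset_prod, Nat.cast_multiset_prod, Multiset.map_map,
    Multiset.map_map, ← Multiset.prod_map_mul]
  congr 1
  refine Multiset.map_congr rfl fun m _ => ?_
  have : (m.factorial : ℚ) ≠ 0 := by exact_mod_cast m.factorial_ne_zero
  simp only [Function.comp_apply, cycleWeight]
  push_cast
  field_simp

end TranspositionFactorizations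

end TranspositionCount

/-- Let `σ` be a permutation of `{1, …, d}`, let `μ = σ.cycleType` be its cycle type
(the multiset of lengths `≥ 2` of the nontrivial cycles of `σ`), and set
`k = μ.sum - μ.card`.  Let `N` be the number of `k`-tuples `(γ 1, …, γ k)` of
transpositions whose product, in the indicated order, is `σ`.  Then
`(∏_{m ∈ μ} m!) * N = k! * ∏_{m ∈ μ} m ^ (m - 1)`. -/
theorem count_minimal_transposition_factorizations (d : ℕ) (σ : Equiv.Perm (Fin d)) (k : ℕ)
    (hk : k = σ.cycleType.sum - σ.cycleType.card) :
    (σ.cycleType.map Nat.factorial).prod *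
      Nat.card {γ : Fin k → Equiv.Perm (Fin d) //
        (∀ i, (γ i).IsSwap) ∧ (List.ofFn γ).prod = σ} =
      k.factorial * (σ.cycleType.map fun m => m ^ (m - 1)).prod := by
  have h := TranspositionCount.swapFactorizations_eq k σ
    (by rw [TranspositionCount.swapLength_eq_sum_sub_card, hk])
  have hw := TranspositionCount.prod_factorial_mul_permWeight σ
  have : ((σ.cycleType.map Nat.factorial).prod : ℚ) *
      TranspositionCount.swapFactorizations k σ =
      k.factorial * ((σ.cycleType.map fun m => m ^ (m - 1)).prod : ℕ) := by
    rw [h, ← hw]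
    ring
  exact_mod_cast this
end

section
/- Let σ be a permutation in S_d with cycle type μ (the multiset of lengths ≥ 2 of its nontrivial cycles), set k = (sum of the parts of μ) − (number of parts of μ), and let (γ_1, …, γ_k) be transpositions in S_d with γ_1 ⋯ γ_k = σ. Then: (i) for every index j there exists a point a in the support of σ such that the support of γ_j is contained in the support of the cycle of σ containing a; (ii) for every a in the support of σ, the number of indices j with support of γ_j contained in the support of the cycle of σ containing a equals (length of that cycle) − 1. -/
open Equiv.Perm

section SwapFactorizations

variable {α β : Type*}

/-- A function invariant under every factor is invariant under the product. -/
theorem apply_list_prod_eq_of_forall_mem {f : α → β} {l : List (Equiv.Perm α)}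
    (h : ∀ g ∈ l, ∀ z, f (g z) = f z) (z : α) : f (l.prod z) = f z := by
  induction l with
  | nil => rfl
  | cons g l ih =>
    rw [List.prod_cons, mul_apply, h g List.mem_cons_self,
      ih fun g' hg' => h g' (List.mem_cons_of_mem g hg')]

/-- A function invariant under a permutation is constant on its cycles. -/
theorem Equiv.Perm.SameCycle.apply_eq_of_invariant [Finite α] {σ : Equiv.Perm α} {f : α → β}
    (h : ∀ z, f (σ z) = f z) {a b : α} (hab : σ.SameCycle a b) : f a = f b := by
  obtain ⟨n, -, rfl⟩ := hab.exists_pow_eq'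
  rw [← List.prod_replicate]
  refine (apply_list_prod_eq_of_forall_mem (fun g hg => ?_) a).symm
  rwa [List.eq_of_mem_replicate hg]

theorem apply_swap_eq_of_apply_eq [DecidableEq α] {f : α → β} {a b : α} (h : f a = f b) (z : α) :
    f (Equiv.swap a b z) = f z := by
  rw [Equiv.swap_apply_def]
  split_ifs with ha hb <;> simp [*]

variable [Fintype α] [DecidableEq α]

/-- Functions invariant under `σ` are determined by their values at the fixed points and at one
point of each nontrivial cycle. -/
theorem finrank_le_of_forall_invariant (σ : Equiv.Perm α) (F : Submodule ℚ (α → ℚ))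
    (hF : ∀ f ∈ F, ∀ z, f (σ z) = f z) :
    Module.finrank ℚ F ≤ (Fintype.card α - σ.support.card) + σ.cycleFactorsFinset.card := by
  classical
  have hrep : ∀ c : σ.cycleFactorsFinset, ∃ z, z ∈ c.1.support := fun c =>
    (mem_cycleFactorsFinset_iff.1 c.2).1.nonempty_support
  choose rep hrep using hrep
  let φ : F →ₗ[ℚ] (↥(σ.supportᶜ) ⊕ ↥σ.cycleFactorsFinset → ℚ) :=
    (LinearMap.funLeft ℚ ℚ (Sum.elim Subtype.val rep)).comp F.subtype
  have hφ : Function.Injective φ := by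
    rw [← LinearMap.ker_eq_bot, LinearMap.ker_eq_bot']
    rintro ⟨f, hf⟩ h
    ext z
    by_cases hz : z ∈ σ.support
    · let c : σ.cycleFactorsFinset := ⟨σ.cycleOf z, cycleOf_mem_cycleFactorsFinset_iff.2 hz⟩
      have hc : f (rep c) = 0 := congrFun h (Sum.inr c)
      exact ((mem_support_cycleOf_iff.1 (hrep c)).1.apply_eq_of_invariant (hF f hf)).trans hc
    · exact congrFun h (Sum.inl ⟨z, Finset.mem_compl.2 hz⟩)
  have := LinearMap.finrank_le_finrank_of_injective hφ
  rwa [Module.finrank_fintype_fun_eq_card, Fintype.card_sum, Fintype.card_coe, Fintype.card_coe,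
    Finset.card_compl] at this

/-- If every function that agrees on each pair `x j`, `y j` is invariant under `σ`, and there are
no more pairs than the size of the support minus the number of nontrivial cycles of `σ`, then each
pair lies in a common cycle of `σ`. -/
theorem sameCycle_of_card_add_card_cycleFactorsFinset_le {ι : Type*} [Fintype ι]
    (σ : Equiv.Perm α) (x y : ι → α)
    (hinv : ∀ f : α → ℚ, (∀ j, f (x j) = f (y j)) → ∀ z, f (σ z) = f z)
    (hcard : Fintype.card ι + σ.cycleFactorsFinset.card ≤ σ.support.card) (j : ι) :
    σ.SameCycle (x j) (y j) := by
  classical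
  let D : (α → ℚ) →ₗ[ℚ] (ι → ℚ) := LinearMap.funLeft ℚ ℚ x - LinearMap.funLeft ℚ ℚ y
  have hD : ∀ f, f ∈ LinearMap.ker D ↔ ∀ j, f (x j) = f (y j) := fun f => by
    simp [D, LinearMap.mem_ker, funext_iff, LinearMap.funLeft_apply, sub_eq_zero]
  let E : (α → ℚ) →ₗ[ℚ] (α → ℚ) := LinearMap.funLeft ℚ ℚ σ - LinearMap.id
  have hE : ∀ f, f ∈ LinearMap.ker E ↔ ∀ z, f (σ z) = f z := fun f => by
    simp [E, LinearMap.mem_ker, funext_iff, LinearMap.funLeft_apply, sub_eq_zero]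
  have hle : LinearMap.ker D ≤ LinearMap.ker E := fun f hf =>
    (hE f).2 (hinv f ((hD f).1 hf))
  have hEdim := finrank_le_of_forall_invariant σ (LinearMap.ker E) fun f hf => (hE f).1 hf
  have hrn := D.finrank_range_add_finrank_ker
  have hrange := (LinearMap.range D).finrank_le
  rw [Module.finrank_fintype_fun_eq_card] at hrn hrange
  have hsupp := σ.support.card_le_univ
  have heq : LinearMap.ker D = LinearMap.ker E :=
    Submodule.eq_of_le_of_finrank_le hle (by omega)
  have hind : (fun z => if σ.SameCycle (x j) z then (1 : ℚ) else 0) ∈ LinearMap.ker D := by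
    rw [heq, hE]
    intro z
    simp only [sameCycle_apply_right]
  have := (hD _).1 hind j
  by_contra hne
  rw [if_pos (SameCycle.refl σ (x j)), if_neg hne] at this
  exact one_ne_zero this

/-- If every function that agrees on each pair `x j`, `y j` is constant on `A`, and no pair is
separated by `A`, then `A` has at most one more point than there are pairs inside it. -/
theorem card_le_card_filter_add_one {ι : Type*} [Fintype ι] (A : Finset α) (x y : ι → α) (a : α)
    (hconst : ∀ f : α → ℚ, (∀ j, f (x j) = f (y j)) → ∀ z ∈ A, f z = f a)
    (hxy : ∀ j, x j ∈ A ↔ y j ∈ A) :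
    A.card ≤ (Finset.univ.filter fun j => x j ∈ A).card + 1 := by
  classical
  let extend : (A → ℚ) →ₗ[ℚ] (α → ℚ) := Function.ExtendByZero.linearMap ℚ Subtype.val
  have extend_mem : ∀ (f : A → ℚ) (z : A), extend f z = f z := fun f z =>
    Subtype.val_injective.extend_apply f 0 z
  have extend_notMem : ∀ (f : A → ℚ), ∀ z ∉ A, extend f z = 0 := fun f z hz =>
    Function.extend_apply' f (0 : α → ℚ) z fun ⟨w, hw⟩ => hz (hw ▸ w.2)
  let J := {j // x j ∈ A}
  let φ : (A → ℚ) →ₗ[ℚ] (J ⊕ Unit → ℚ) :=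
    (LinearMap.funLeft ℚ ℚ (Sum.elim (fun j : J => x j) fun _ => a) -
      LinearMap.pi (Sum.elim (fun j : J => LinearMap.proj (y j)) fun _ => 0)).comp extend
  have hφ : Function.Injective φ := by
    rw [← LinearMap.ker_eq_bot, LinearMap.ker_eq_bot']
    intro f hf
    have ha : extend f a = 0 := by
      simpa [φ, LinearMap.funLeft_apply] using congrFun hf (Sum.inr ())
    have hJ : ∀ j, extend f (x j) = extend f (y j) := fun j => by
      by_cases hj : x j ∈ A
      · simpa [φ, LinearMap.funLeft_apply, sub_eq_zero] using congrFun hf (Sum.inl ⟨j, hj⟩)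
      · rw [extend_notMem f _ hj, extend_notMem f _ (mt (hxy j).2 hj)]
    ext z
    rw [← extend_mem f z, hconst _ hJ z z.2, ha, Pi.zero_apply]
  have := LinearMap.finrank_le_finrank_of_injective hφ
  simpa [J, Fintype.card_subtype] using this

theorem sum_cycleType_sub_card_cycleType (σ : Equiv.Perm α) :
    σ.cycleType.sum - σ.cycleType.card = ∑ c ∈ σ.cycleFactorsFinset, (c.support.card - 1) := by
  rw [Finset.sum_tsub_distrib _ fun c hc =>
    (mem_cycleFactorsFinset_iff.1 hc).1.nonempty_support.card_pos]
  simp [cycleType_def]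

theorem sum_card_support_sub_one_add_card (σ : Equiv.Perm α) :
    ∑ c ∈ σ.cycleFactorsFinset, (c.support.card - 1) + σ.cycleFactorsFinset.card =
      σ.support.card := by
  rw [← sum_cycleType, cycleType_def, Finset.card_eq_sum_ones, ← Finset.sum_add_distrib]
  exact Finset.sum_congr rfl fun c hc =>
    Nat.sub_add_cancel (mem_cycleFactorsFinset_iff.1 hc).1.nonempty_support.card_pos

theorem mem_support_iff_of_sameCycle {σ c : Equiv.Perm α} (hc : c ∈ σ.cycleFactorsFinset)
    {a b : α} (h : σ.SameCycle a b) : a ∈ c.support ↔ b ∈ c.support := by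
  obtain ⟨z, hz⟩ := (mem_cycleFactorsFinset_iff.1 hc).1.nonempty_support
  rw [cycle_is_cycleOf hz hc, mem_support_cycleOf_iff, mem_support_cycleOf_iff]
  exact and_congr_left fun _ => ⟨fun h' => h'.trans h, fun h' => h'.trans h.symm⟩

/-- If every function that agrees on each pair `x j`, `y j` is invariant under `σ`, each pair lies
in a common cycle of `σ`, and there are as few pairs as possible, then a nontrivial cycle of
length `m` contains exactly `m - 1` of them. -/
theorem card_filter_mem_support_eq {ι : Type*} [Fintype ι] (σ : Equiv.Perm α) (x y : ι → α)
    (hinv : ∀ f : α → ℚ, (∀ j, f (x j) = f (y j)) → ∀ z, f (σ z) = f z)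
    (hcard : Fintype.card ι = ∑ c ∈ σ.cycleFactorsFinset, (c.support.card - 1))
    (hxy : ∀ j, σ.SameCycle (x j) (y j)) {c : Equiv.Perm α} (hc : c ∈ σ.cycleFactorsFinset) :
    (Finset.univ.filter fun j => x j ∈ c.support).card = c.support.card - 1 := by
  classical
  have hlower : ∀ c ∈ σ.cycleFactorsFinset,
      c.support.card - 1 ≤ (Finset.univ.filter fun j => x j ∈ c.support).card := by
    intro c hc
    obtain ⟨a, ha⟩ := (mem_cycleFactorsFinset_iff.1 hc).1.nonempty_support
    refine Nat.sub_le_of_le_add (card_le_card_filter_add_one c.support x y a (fun f hf z hz => ?_)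
      fun j => mem_support_iff_of_sameCycle hc (hxy j))
    rw [cycle_is_cycleOf ha hc, mem_support_cycleOf_iff] at hz
    exact (hz.1.apply_eq_of_invariant (hinv f hf)).symm
  have hupper : ∑ c ∈ σ.cycleFactorsFinset,
      (Finset.univ.filter fun j => x j ∈ c.support).card ≤ Fintype.card ι := by
    rw [← Finset.card_biUnion]
    · exact Finset.card_le_univ _
    · intro c hc c' hc' hne
      refine Finset.disjoint_filter.2 fun j _ h h' => ?_
      exact Finset.disjoint_left.1
        (cycleFactorsFinset_pairwise_disjoint σ hc hc' hne).disjoint_support h h'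
  exact ((Finset.sum_eq_sum_iff_of_le hlower).1
    ((Finset.sum_le_sum hlower).antisymm (hupper.trans hcard.le)) c hc).symm

end SwapFactorizations

/-- Let `σ` be a permutation of `{1, …, d}` with cycle type `μ`, set
`k = μ.sum - μ.card`, and let `(γ 1, …, γ k)` be transpositions with product `σ`
(in the indicated order).  Then:
(i) for every index `j` there is a point `a` in the support of `σ` such that the
support of `γ j` is contained in the support of the cycle of `σ` containing `a`;
(ii) for every `a` in the support of `σ`, the number of indices `j` whose
transposition is supported in the cycle of `σ` through `a` equals
(length of that cycle) − 1. -/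
theorem transpositions_distribute_over_cycles (d : ℕ) (σ : Equiv.Perm (Fin d)) (k : ℕ)
    (hk : k = σ.cycleType.sum - σ.cycleType.card)
    (γ : Fin k → Equiv.Perm (Fin d)) (hswap : ∀ i, (γ i).IsSwap)
    (hprod : (List.ofFn γ).prod = σ) :
    (∀ j, ∃ a ∈ σ.support, (γ j).support ⊆ (σ.cycleOf a).support) ∧
    (∀ a ∈ σ.support,
      (Finset.univ.filter fun j => (γ j).support ⊆ (σ.cycleOf a).support).card =
        (σ.cycleOf a).support.card - 1) := by
  choose x y hne hγ using hswap
  have hsub : ∀ j (B : Finset (Fin d)), (γ j).support ⊆ B ↔ x j ∈ B ∧ y j ∈ B := fun j B => by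
    rw [hγ j, support_swap (hne j), Finset.insert_subset_iff, Finset.singleton_subset_iff]
  have hinv : ∀ f : Fin d → ℚ, (∀ j, f (x j) = f (y j)) → ∀ z, f (σ z) = f z := by
    intro f hf z
    rw [← hprod]
    refine apply_list_prod_eq_of_forall_mem (fun g hg => ?_) z
    obtain ⟨j, rfl⟩ := List.mem_ofFn.1 hg
    rw [hγ j]
    exact apply_swap_eq_of_apply_eq (hf j)
  have hcard : Fintype.card (Fin k) = ∑ c ∈ σ.cycleFactorsFinset, (c.support.card - 1) := by
    rw [Fintype.card_fin, hk, sum_cycleType_sub_card_cycleType]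
  have hxy : ∀ j, σ.SameCycle (x j) (y j) :=
    sameCycle_of_card_add_card_cycleFactorsFinset_le σ x y hinv
      (by rw [hcard, sum_card_support_sub_one_add_card])
  refine ⟨fun j => ?_, fun a ha => ?_⟩
  · have hx : x j ∈ σ.support :=
      mem_support.2 fun h => hne j ((hxy j).eq_of_left h)
    refine ⟨x j, hx, (hsub j _).2 ⟨?_, ?_⟩⟩
    · exact mem_support_cycleOf_iff.2 ⟨SameCycle.refl σ _, hx⟩
    · exact mem_support_cycleOf_iff.2 ⟨hxy j, hx⟩
  · have hc := cycleOf_mem_cycleFactorsFinset_iff.2 ha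
    rw [← card_filter_mem_support_eq σ x y hinv hcard hxy hc]
    congr 1
    refine Finset.filter_congr fun j _ => ?_
    rw [hsub, ← mem_support_iff_of_sameCycle hc (hxy j), and_self]
end
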